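/- arXiv:2404.11902 — 6 statements merged into one kernel-verified Lean document; each statement's English description precedes it below -/
import Mathlib

section
/- For every nontrivial zero ρ of the Riemann zeta function, every real x > 0 and every positive integer l, δ_{l,ρ}(x) = M_η(1−ρ)·(l+1/2)^ρ/(ρ·x^ρ) + 4π·((l+1/2)/x)^ρ·∫_{(l+1/2)/x}^∞ e^{−πu²}·u^{2−ρ} du, where M_η(1−ρ) = ∫₀^∞ η(t)·t^{−ρ} dt. -/
open MeasureTheory Real Filter

/-- The function `η(x) = 8πx²(πx² − 3/2)e^{−πx²}`. -/
noncomputable def eta (x : ℝ) : ℝ :=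
  8 * π * x ^ 2 * (π * x ^ 2 - 3 / 2) * Real.exp (-π * x ^ 2)

/-- `g ρ = Z⁻¹ F_ρ`, given by `g ρ t = ∫₁^∞ η(u·t)·u^{ρ−1} du`. -/
noncomputable def g (ρ : ℂ) (t : ℝ) : ℂ :=
  ∫ u in Set.Ioi (1 : ℝ), (eta (u * t) : ℂ) * (u : ℂ) ^ (ρ - 1)

/-- `F_ρ x = ∫₁^∞ (Σ_{n≥1} η(n·t·x))·t^{ρ−1} dt`. -/
noncomputable def F (ρ : ℂ) (x : ℝ) : ℂ :=
  ∫ t in Set.Ioi (1 : ℝ), (∑' n : ℕ, (eta (((n : ℝ) + 1) * t * x) : ℂ)) * (t : ℂ) ^ (ρ - 1)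

/-- `δ_{l,ρ}(x) = ∫₀^∞ g ρ (x·t)·sin((2l+1)πt)/(πt) dt`. -/
noncomputable def delta (l : ℕ) (ρ : ℂ) (x : ℝ) : ℂ :=
  ∫ t in Set.Ioi (0 : ℝ),
    g ρ (x * t) * ((Real.sin ((2 * (l : ℝ) + 1) * π * t) / (π * t) : ℝ) : ℂ)

/-- The Fourier transform `𝔉f(y) = ∫_ℝ f(x)·e^{2πixy} dx`. -/
noncomputable def FT (f : ℝ → ℂ) (y : ℝ) : ℂ :=
  ∫ x : ℝ, f x * Complex.exp (((2 * π * x * y : ℝ) : ℂ) * Complex.I)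

lemma integrable_pow_mul_gaussian (n : ℕ) :
    Integrable (fun s : ℝ => s ^ n * Real.exp (-π * s ^ 2)) := by
  have h := integrable_rpow_mul_exp_neg_mul_sq Real.pi_pos (s := n)
    (by have : (0 : ℝ) ≤ n := n.cast_nonneg
        linarith)
  simpa only [Real.rpow_natCast] using h

lemma tendsto_rpow_mul_gaussian (σ : ℝ) :
    Tendsto (fun s : ℝ => s ^ σ * Real.exp (-π * s ^ 2)) atTop (nhds 0) := by
  refine (rpow_mul_exp_neg_mul_sq_isLittleO_exp_neg Real.pi_pos σ).trans_tendsto ?_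
  refine Real.tendsto_exp_atBot.comp ?_
  exact tendsto_id.const_mul_atTop_of_neg (by norm_num)

lemma tendsto_pow_mul_gaussian (n : ℕ) :
    Tendsto (fun s : ℝ => s ^ n * Real.exp (-π * s ^ 2)) atTop (nhds 0) := by
  simpa only [Real.rpow_natCast] using tendsto_rpow_mul_gaussian n

lemma hasDerivAt_gaussian (s : ℝ) :
    HasDerivAt (fun s : ℝ => Real.exp (-π * s ^ 2))
      (Real.exp (-π * s ^ 2) * (-2 * π * s)) s := by
  have h := ((hasDerivAt_pow 2 s).const_mul (-π)).exp
  convert h using 1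
  push_cast
  ring

/-- The cosine transform of the Gaussian. -/
lemma integral_gaussian_mul_cos (a : ℝ) :
    ∫ s in Set.Ioi (0 : ℝ), Real.exp (-π * s ^ 2) * Real.cos (2 * π * a * s)
      = Real.exp (-π * a ^ 2) / 2 := by
  have hpi : (π : ℂ) ≠ 0 := by exact_mod_cast Real.pi_ne_zero
  have hFT := fourierIntegral_gaussian (b := (π : ℂ)) (by simpa using Real.pi_pos)
    ((2 * π * a : ℝ) : ℂ)
  have hrhs : ((π : ℂ) / π) ^ (1 / 2 : ℂ) * Complex.exp (-((2 * π * a : ℝ) : ℂ) ^ 2 / (4 * π))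
      = ((Real.exp (-π * a ^ 2) : ℝ) : ℂ) := by
    rw [div_self hpi, Complex.one_cpow, one_mul, Complex.ofReal_exp]
    congr 1
    push_cast
    field_simp
    ring
  rw [hrhs] at hFT
  have hint : Integrable (fun s : ℝ => Complex.exp (Complex.I * ((2 * π * a : ℝ) : ℂ) * s) *
      Complex.exp (-(π : ℂ) * (s : ℂ) ^ 2)) := by
    by_contra hcon
    rw [integral_undef hcon] at hFT
    exact (Real.exp_pos _).ne (by exact_mod_cast hFT)
  have hre := congrArg Complex.re hFT
  rw [Complex.ofReal_re, ← RCLike.re_eq_complex_re, ← integral_re hint] at hre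
  have habs := integral_comp_abs
    (f := fun s => Real.exp (-π * s ^ 2) * Real.cos (2 * π * a * s))
  have heq : ∀ s : ℝ, RCLike.re (Complex.exp (Complex.I * ((2 * π * a : ℝ) : ℂ) * s) *
      Complex.exp (-(π : ℂ) * (s : ℂ) ^ 2))
      = Real.exp (-π * |s| ^ 2) * Real.cos (2 * π * a * |s|) := by
    intro s
    have hcos : Real.cos (2 * π * a * |s|) = Real.cos (2 * π * a * s) := by
      rcases abs_choice s with h | h <;> rw [h]
      rw [mul_neg, Real.cos_neg]
    have hexp : Complex.exp (-(π : ℂ) * (s : ℂ) ^ 2) = ((Real.exp (-π * s ^ 2) : ℝ) : ℂ) := by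
      push_cast
      rfl
    have hI : Complex.I * ((2 * π * a : ℝ) : ℂ) * s = ((2 * π * a * s : ℝ) : ℂ) * Complex.I := by
      push_cast
      ring
    rw [hcos, sq_abs, hexp, hI, RCLike.re_eq_complex_re, Complex.re_mul_ofReal,
      Complex.exp_ofReal_mul_I_re, mul_comm]
  simp_rw [heq] at hre
  linarith

/-- The sine transform of `η(s)/s`, evaluated through an explicit antiderivative modulo a multiple
of the Gaussian cosine transform. -/
lemma integral_gaussian_mul_sin (a : ℝ) :
    ∫ s in Set.Ioi (0 : ℝ),
        (8 * π * s ^ 3 - 12 * s) * Real.exp (-π * s ^ 2) * Real.sin (2 * π * a * s)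
      = -4 * π * a ^ 3 * Real.exp (-π * a ^ 2) := by
  have hpi := Real.pi_ne_zero
  have hbdd (f : ℝ → ℝ) (hf : Continuous f) (h1 : ∀ s, |f s| ≤ 1) (n : ℕ) :
      Integrable (fun s : ℝ => s ^ n * Real.exp (-π * s ^ 2) * f s) :=
    (integrable_pow_mul_gaussian n).mul_bdd hf.aestronglyMeasurable
      (Eventually.of_forall h1)
  have hsin := hbdd (fun s => Real.sin (2 * π * a * s)) (by fun_prop)
    (fun s => Real.abs_sin_le_one _)
  have hcos := hbdd (fun s => Real.cos (2 * π * a * s)) (by fun_prop)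
    (fun s => Real.abs_cos_le_one _)
  have htend (f : ℝ → ℝ) (h1 : ∀ s, |f s| ≤ 1) (n : ℕ) :
      Tendsto (fun s : ℝ => s ^ n * Real.exp (-π * s ^ 2) * f s) atTop (nhds 0) := by
    refine (tendsto_pow_mul_gaussian n).zero_mul_isBoundedUnder_le ?_
    exact isBoundedUnder_of ⟨1, h1⟩
  have htsin := htend (fun s => Real.sin (2 * π * a * s)) (fun s => Real.abs_sin_le_one _)
  have htcos := htend (fun s => Real.cos (2 * π * a * s)) (fun s => Real.abs_cos_le_one _)
  let f : ℝ → ℝ := fun s => Real.exp (-π * s ^ 2) *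
    ((-4 * s ^ 2 + (4 * a ^ 2 + 2 / π)) * Real.sin (2 * π * a * s)
      + (-4 * a * s) * Real.cos (2 * π * a * s))
  let f' : ℝ → ℝ := fun s =>
    (8 * π * s ^ 3 - 12 * s) * Real.exp (-π * s ^ 2) * Real.sin (2 * π * a * s)
      + 8 * π * a ^ 3 * (Real.exp (-π * s ^ 2) * Real.cos (2 * π * a * s))
  have hderiv : ∀ s, HasDerivAt f (f' s) s := by
    intro s
    have hlin : HasDerivAt (fun s : ℝ => 2 * π * a * s) (2 * π * a) s := by
      simpa using (hasDerivAt_id s).const_mul (2 * π * a)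
    have hP := ((hasDerivAt_pow 2 s).const_mul (-4)).add_const (4 * a ^ 2 + 2 / π)
    have hQ : HasDerivAt (fun s : ℝ => -4 * a * s) (-4 * a) s := by
      simpa using (hasDerivAt_id s).const_mul (-4 * a)
    have h := (hasDerivAt_gaussian s).mul ((hP.mul hlin.sin).add (hQ.mul hlin.cos))
    refine h.congr_deriv ?_
    simp only [f', Pi.add_apply, Pi.mul_apply]
    push_cast
    field_simp
    ring
  have hi1 : Integrable (fun s : ℝ =>
      (8 * π * s ^ 3 - 12 * s) * Real.exp (-π * s ^ 2) * Real.sin (2 * π * a * s)) := by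
    refine (((hsin 3).const_mul (8 * π)).sub ((hsin 1).const_mul 12)).congr
      (Eventually.of_forall fun s => ?_)
    simp only [Pi.sub_apply]
    ring
  have hi2 : Integrable (fun s : ℝ =>
      8 * π * a ^ 3 * (Real.exp (-π * s ^ 2) * Real.cos (2 * π * a * s))) := by
    simpa using (hcos 0).const_mul (8 * π * a ^ 3)
  have hlim : Tendsto f atTop (nhds 0) := by
    have h := (((htsin 2).const_mul (-4)).add ((htsin 0).const_mul (4 * a ^ 2 + 2 / π))).add
      ((htcos 1).const_mul (-4 * a))
    simp only [mul_zero, add_zero] at h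
    refine h.congr fun s => ?_
    simp only [f]
    ring
  have key := integral_Ioi_of_hasDerivAt_of_tendsto (a := 0)
    (hderiv 0).continuousAt.continuousWithinAt (fun s _ => hderiv s)
    (hi1.add hi2).integrableOn hlim
  rw [show f 0 = 0 by simp [f], integral_add hi1.integrableOn hi2.integrableOn,
    integral_const_mul, integral_gaussian_mul_cos] at key
  linarith

lemma integral_eta_mul_sin (a c L : ℝ) (hc : 0 < c) (hL : L = a * c) :
    ∫ t in Set.Ioi (0 : ℝ), eta (c * t) * (Real.sin (2 * π * L * t) / (π * t))
      = -4 * π * a ^ 3 * Real.exp (-π * a ^ 2) := by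
  have h := integral_comp_mul_left_Ioi (fun s : ℝ =>
    (8 * π * s ^ 3 - 12 * s) * Real.exp (-π * s ^ 2) * Real.sin (2 * π * a * s)) 0 hc
  rw [mul_zero, integral_gaussian_mul_sin] at h
  rw [← mul_inv_cancel_left₀ hc.ne' (-4 * π * a ^ 3 * _), ← smul_eq_mul (c⁻¹), ← h,
    ← integral_const_mul]
  refine setIntegral_congr_fun measurableSet_Ioi fun t ht => ?_
  have ht0 : t ≠ 0 := (Set.mem_Ioi.mp ht).ne'
  have hpi := Real.pi_ne_zero
  simp only [eta, hL]
  rw [show 2 * π * (a * c) * t = 2 * π * a * (c * t) by ring]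
  field_simp
  ring

lemma integrable_eta : Integrable eta := by
  refine (((integrable_pow_mul_gaussian 4).const_mul (8 * π ^ 2)).sub
    ((integrable_pow_mul_gaussian 2).const_mul (12 * π))).congr
      (Eventually.of_forall fun s => ?_)
  simp only [Pi.sub_apply, eta]
  ring

lemma continuous_eta : Continuous eta := by
  unfold eta
  fun_prop

lemma integrableOn_gaussian_mul_cpow {z : ℂ} (hz : -1 < z.re) :
    IntegrableOn (fun u : ℝ => (Real.exp (-π * u ^ 2) : ℂ) * (u : ℂ) ^ z) (Set.Ioi 0) := by
  refine (integrableOn_rpow_mul_exp_neg_mul_sq Real.pi_pos hz).mono' ?_ ?_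
  · exact (by fun_prop : Measurable fun u : ℝ =>
      (Real.exp (-π * u ^ 2) : ℂ) * (u : ℂ) ^ z).aestronglyMeasurable
  · filter_upwards [ae_restrict_mem measurableSet_Ioi] with u hu
    rw [norm_mul, Complex.norm_real, Real.norm_of_nonneg (Real.exp_pos _).le,
      Complex.norm_cpow_eq_rpow_re_of_pos hu, mul_comm]

/-- The Mellin transform of `η` by partial integration. -/
lemma integral_eta_mul_cpow (ρ : ℂ) (hρ : ρ.re < 1) :
    ∫ t in Set.Ioi (0 : ℝ), (eta t : ℂ) * (t : ℂ) ^ (-ρ)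
      = -4 * π * ρ * ∫ u in Set.Ioi (0 : ℝ), (Real.exp (-π * u ^ 2) : ℂ) * (u : ℂ) ^ (2 - ρ) := by
  have hre3 : 0 < (3 - ρ).re := by
    simp only [Complex.sub_re, Complex.re_ofNat]
    linarith
  have hne : (3 : ℂ) - ρ ≠ 0 := fun h => by simp [h] at hre3
  have hcpow {t : ℝ} (ht : 0 < t) (n : ℕ) :
      (t : ℂ) ^ ((n : ℂ) - ρ) = (t : ℂ) ^ n * (t : ℂ) ^ (-ρ) := by
    rw [sub_eq_add_neg, Complex.cpow_add _ _ (by exact_mod_cast ht.ne'), Complex.cpow_natCast]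
  let f : ℝ → ℂ := fun t => (Real.exp (-π * t ^ 2) : ℂ) * (t : ℂ) ^ (3 - ρ)
  let f' : ℝ → ℂ := fun t => (3 - ρ) * ((Real.exp (-π * t ^ 2) : ℂ) * (t : ℂ) ^ (2 - ρ))
    - 2 * π * ((Real.exp (-π * t ^ 2) : ℂ) * (t : ℂ) ^ (4 - ρ))
  have hderiv : ∀ t ∈ Set.Ioi (0 : ℝ), HasDerivAt f (f' t) t := by
    intro t ht
    have ht0 : (0 : ℝ) < t := ht
    have h := (hasDerivAt_gaussian t).ofReal_comp.mul
      (hasDerivAt_ofReal_cpow_const ht0.ne' hne)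
    refine h.congr_deriv ?_
    have h3 := hcpow ht0 3
    have h2 := hcpow ht0 2
    have h4 := hcpow ht0 4
    push_cast at h2 h3 h4
    rw [show (3 : ℂ) - ρ - 1 = 2 - ρ by ring]
    simp only [f']
    rw [h2, h3, h4]
    push_cast
    ring
  have hi2 := integrableOn_gaussian_mul_cpow (z := 2 - ρ) (by
    simp only [Complex.sub_re, Complex.re_ofNat]
    linarith)
  have hi4 := integrableOn_gaussian_mul_cpow (z := 4 - ρ) (by
    simp only [Complex.sub_re, Complex.re_ofNat]
    linarith)
  have hlim : Tendsto f atTop (nhds 0) := by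
    rw [tendsto_zero_iff_norm_tendsto_zero]
    refine (tendsto_rpow_mul_gaussian (3 - ρ).re).congr' ?_
    filter_upwards [eventually_gt_atTop 0] with t ht
    rw [norm_mul, Complex.norm_real, Real.norm_of_nonneg (Real.exp_pos _).le,
      Complex.norm_cpow_eq_rpow_re_of_pos ht, mul_comm]
  have hcont : ContinuousWithinAt f (Set.Ici 0) 0 := by
    refine ContinuousAt.continuousWithinAt (ContinuousAt.mul (by fun_prop) ?_)
    exact Complex.continuousAt_ofReal_cpow_const 0 _ (Or.inl hre3)
  have key := integral_Ioi_of_hasDerivAt_of_tendsto hcont hderiv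
    ((hi2.const_mul _).sub (hi4.const_mul _)) hlim
  rw [show f 0 = 0 by simp [f, Complex.zero_cpow hne], sub_zero,
    integral_sub (hi2.const_mul _) (hi4.const_mul _), integral_const_mul, integral_const_mul]
    at key
  have heta : ∫ t in Set.Ioi (0 : ℝ), (eta t : ℂ) * (t : ℂ) ^ (-ρ)
      = ∫ t in Set.Ioi (0 : ℝ),
        (8 * (π : ℂ) ^ 2 * ((Real.exp (-π * t ^ 2) : ℂ) * (t : ℂ) ^ (4 - ρ))
          - 12 * (π : ℂ) * ((Real.exp (-π * t ^ 2) : ℂ) * (t : ℂ) ^ (2 - ρ))) := by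
    refine setIntegral_congr_fun measurableSet_Ioi fun t ht => ?_
    have h2 := hcpow ht 2
    have h4 := hcpow ht 4
    push_cast at h2 h4
    simp only [eta]
    rw [h2, h4]
    push_cast
    ring
  rw [heta, integral_sub (hi4.const_mul _) (hi2.const_mul _), integral_const_mul,
    integral_const_mul]
  linear_combination (-4 * (π : ℂ)) * key

lemma integral_comp_div_Ioi_one {A : ℝ} (hA : 0 < A) (ρ : ℂ) :
    ∫ u in Set.Ioi (1 : ℝ), (u : ℂ) ^ (ρ - 1) *
        ((-4 * π * (A / u) ^ 3 * Real.exp (-π * (A / u) ^ 2) : ℝ) : ℂ)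
      = -4 * π * (A : ℂ) ^ ρ *
        ∫ v in Set.Ioo 0 A, (Real.exp (-π * v ^ 2) : ℂ) * (v : ℂ) ^ (2 - ρ) := by
  have himage : (fun u : ℝ => A / u) '' Set.Ioi 1 = Set.Ioo 0 A := by
    ext v
    constructor
    · rintro ⟨u, hu, rfl⟩
      have hu1 : (1 : ℝ) < u := hu
      exact ⟨div_pos hA (by linarith), div_lt_self hA hu1⟩
    · rintro ⟨h0, h1⟩
      exact ⟨A / v, (one_lt_div h0).mpr h1, by field_simp⟩
  have hderiv : ∀ u ∈ Set.Ioi (1 : ℝ),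
      HasDerivWithinAt (fun u : ℝ => A / u) (-A / u ^ 2) (Set.Ioi 1) u := by
    intro u hu
    have hu0 : u ≠ 0 := (lt_trans one_pos (Set.mem_Ioi.mp hu)).ne'
    have h := (hasDerivAt_inv hu0).const_mul A
    refine (h.congr_deriv ?_).hasDerivWithinAt
    ring
  have hinj : Set.InjOn (fun u : ℝ => A / u) (Set.Ioi 1) := by
    intro u hu v hv huv
    have hu0 : u ≠ 0 := (lt_trans one_pos (Set.mem_Ioi.mp hu)).ne'
    have hv0 : v ≠ 0 := (lt_trans one_pos (Set.mem_Ioi.mp hv)).ne'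
    simp only at huv
    field_simp at huv
    exact huv.symm
  rw [← himage, integral_image_eq_integral_abs_deriv_smul measurableSet_Ioi hderiv hinj,
    ← integral_const_mul]
  refine setIntegral_congr_fun measurableSet_Ioi fun u hu => ?_
  have hu0 : (0 : ℝ) < u := lt_trans one_pos hu
  have huC : (u : ℂ) ≠ 0 := by exact_mod_cast hu0.ne'
  have hAC : (A : ℂ) ≠ 0 := by exact_mod_cast hA.ne'
  have huρ : (u : ℂ) ^ ρ ≠ 0 := by simp [Complex.cpow_eq_zero_iff, huC]
  have hAρ : (A : ℂ) ^ ρ ≠ 0 := by simp [Complex.cpow_eq_zero_iff, hAC]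
  have habs : |-A / u ^ 2| = A / u ^ 2 := by
    rw [neg_div, abs_neg, abs_of_pos (by positivity)]
  have hdiv : ((A / u : ℝ) : ℂ) ^ (2 - ρ) = (A / u : ℂ) ^ 2 * ((u : ℂ) ^ ρ / (A : ℂ) ^ ρ) := by
    have hne : ((A / u : ℝ) : ℂ) ≠ 0 := by exact_mod_cast (div_pos hA hu0).ne'
    rw [Complex.cpow_sub _ _ hne, Complex.ofReal_div, Complex.cpow_ofNat, ← Complex.ofReal_div,
      Complex.ofReal_div, Complex.div_cpow_ofReal_nonneg hA.le hu0.le]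
    field_simp
  simp only [habs]
  rw [hdiv, Complex.real_smul, Complex.cpow_sub _ _ huC, Complex.cpow_one]
  push_cast
  field_simp

lemma integrable_delta_kernel (ρ : ℂ) (hρ : ρ.re < 1) {x L : ℝ} (hx : 0 < x) (hL : 0 < L) :
    Integrable (Function.uncurry fun t u : ℝ => (eta (u * (x * t)) : ℂ) * (u : ℂ) ^ (ρ - 1) *
        ((Real.sin (2 * π * L * t) / (π * t) : ℝ) : ℂ))
      ((volume.restrict (Set.Ioi 0)).prod (volume.restrict (Set.Ioi 1))) := by
  have hmeta : Measurable eta := continuous_eta.measurable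
  have hbound : Integrable (fun p : ℝ × ℝ => 2 * L * |eta (p.1 * x * p.2)| * p.1 ^ (ρ.re - 1))
      ((volume.restrict (Set.Ioi 1)).prod (volume.restrict (Set.Ioi 0))) := by
    rw [integrable_prod_iff (by
      exact (by fun_prop : Measurable fun p : ℝ × ℝ =>
        2 * L * |eta (p.1 * x * p.2)| * p.1 ^ (ρ.re - 1)).aestronglyMeasurable)]
    constructor
    · filter_upwards [ae_restrict_mem measurableSet_Ioi] with u hu
      have hux : 0 < u * x := mul_pos (lt_trans one_pos hu) hx
      have h := (integrableOn_Ioi_comp_mul_left_iff (fun s => |eta s|) 0 hux).mpr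
        integrable_eta.abs.integrableOn
      exact (h.const_mul _).mul_const _
    · have h := ((integrableOn_Ioi_rpow_of_lt (a := ρ.re - 2) (by linarith) one_pos).const_mul
        (2 * L * x⁻¹ * ∫ s in Set.Ioi (0 : ℝ), |eta s|))
      refine h.congr ?_
      filter_upwards [ae_restrict_mem measurableSet_Ioi] with u hu
      have hu0 : (0 : ℝ) < u := lt_trans one_pos hu
      have hnorm : ∀ t : ℝ, ‖2 * L * |eta (u * x * t)| * u ^ (ρ.re - 1)‖
          = (2 * L * u ^ (ρ.re - 1)) * |eta (u * x * t)| := by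
        intro t
        rw [Real.norm_of_nonneg (by positivity)]
        ring
      simp only [hnorm]
      rw [integral_const_mul, integral_comp_mul_left_Ioi (fun s => |eta s|) 0 (mul_pos hu0 hx),
        mul_zero, smul_eq_mul, show ρ.re - 2 = ρ.re - 1 - 1 by ring, Real.rpow_sub_one hu0.ne']
      field_simp
  refine hbound.swap.mono' ?_ ?_
  · refine Measurable.aestronglyMeasurable ?_
    simp only [Function.uncurry_def]
    fun_prop
  · rw [Measure.prod_restrict]
    filter_upwards [ae_restrict_mem (measurableSet_Ioi.prod measurableSet_Ioi)] with p hp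
    obtain ⟨t, u⟩ := p
    have ht : (0 : ℝ) < t := hp.1
    have hu : (0 : ℝ) < u := lt_trans one_pos hp.2
    have hsin : |Real.sin (2 * π * L * t) / (π * t)| ≤ 2 * L := by
      have hπt : 0 < π * t := mul_pos Real.pi_pos ht
      rw [abs_div, abs_of_pos hπt, div_le_iff₀ hπt]
      refine Real.abs_sin_le_abs.trans (le_of_eq ?_)
      have := Real.pi_pos
      rw [abs_of_pos (by positivity)]
      ring
    simp only [Function.uncurry_apply_pair, Function.comp_apply, Prod.swap_prod_mk]
    rw [norm_mul, norm_mul, Complex.norm_real, Complex.norm_real, Real.norm_eq_abs,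
      Real.norm_eq_abs, Complex.norm_cpow_eq_rpow_re_of_pos hu, Complex.sub_re, Complex.one_re,
      mul_assoc u x t]
    have hrpow : 0 ≤ u ^ (ρ.re - 1) := Real.rpow_nonneg hu.le _
    calc |eta (u * (x * t))| * u ^ (ρ.re - 1) * |Real.sin (2 * π * L * t) / (π * t)|
        ≤ |eta (u * (x * t))| * u ^ (ρ.re - 1) * (2 * L) := by gcongr
      _ = 2 * L * |eta (u * (x * t))| * u ^ (ρ.re - 1) := by ring

lemma delta_eq_integral_Ioo (ρ : ℂ) (hρ : ρ.re < 1) {x : ℝ} (hx : 0 < x) (l : ℕ) :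
    delta l ρ x = -4 * π * ((((l : ℝ) + 1 / 2) / x : ℝ) : ℂ) ^ ρ *
      ∫ v in Set.Ioo 0 (((l : ℝ) + 1 / 2) / x),
        (Real.exp (-π * v ^ 2) : ℂ) * (v : ℂ) ^ (2 - ρ) := by
  have hL : (0 : ℝ) < (l : ℝ) + 1 / 2 := by positivity
  rw [← integral_comp_div_Ioi_one (div_pos hL hx)]
  have hfreq : ∀ t : ℝ, (2 * (l : ℝ) + 1) * π * t = 2 * π * ((l : ℝ) + 1 / 2) * t := by
    intro t
    ring
  simp only [delta, g, hfreq, ← integral_mul_const]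
  rw [integral_integral_swap (integrable_delta_kernel ρ hρ hx hL)]
  refine setIntegral_congr_fun measurableSet_Ioi fun u hu => ?_
  have hu0 : (0 : ℝ) < u := lt_trans one_pos hu
  rw [← integral_eta_mul_sin (((l : ℝ) + 1 / 2) / x / u) (u * x) ((l : ℝ) + 1 / 2)
    (mul_pos hu0 hx) (by field_simp), ← integral_complex_ofReal, ← integral_const_mul]
  refine setIntegral_congr_fun measurableSet_Ioi fun t _ => ?_
  simp only [mul_assoc u x t]
  push_cast
  ring

theorem stmt_0 (ρ : ℂ) (hζ : riemannZeta ρ = 0) (hρ0 : 0 < ρ.re) (hρ1 : ρ.re < 1)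
    (x : ℝ) (hx : 0 < x) (l : ℕ) (hl : 0 < l) :
    delta l ρ x =
      (∫ t in Set.Ioi (0 : ℝ), (eta t : ℂ) * (t : ℂ) ^ (-ρ)) * ((l : ℂ) + 1 / 2) ^ ρ
          / (ρ * (x : ℂ) ^ ρ)
        + 4 * (π : ℂ) * ((((l : ℝ) + 1 / 2) / x : ℝ) : ℂ) ^ ρ *
            ∫ u in Set.Ioi (((l : ℝ) + 1 / 2) / x),
              (Real.exp (-π * u ^ 2) : ℂ) * (u : ℂ) ^ (2 - ρ) := by
  have hL : (0 : ℝ) < (l : ℝ) + 1 / 2 := by positivity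
  have hA : 0 < ((l : ℝ) + 1 / 2) / x := div_pos hL hx
  have hρ : ρ ≠ 0 := fun h => by simp [h] at hρ0
  have hxρ : (x : ℂ) ^ ρ ≠ 0 := by simp [Complex.cpow_eq_zero_iff, hx.ne']
  have hint := integrableOn_gaussian_mul_cpow (z := 2 - ρ) (by
    simp only [Complex.sub_re, Complex.re_ofNat]
    linarith)
  have hsplit : ∫ u in Set.Ioi (0 : ℝ), (Real.exp (-π * u ^ 2) : ℂ) * (u : ℂ) ^ (2 - ρ)
      = (∫ u in Set.Ioo 0 (((l : ℝ) + 1 / 2) / x),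
          (Real.exp (-π * u ^ 2) : ℂ) * (u : ℂ) ^ (2 - ρ))
        + ∫ u in Set.Ioi (((l : ℝ) + 1 / 2) / x),
          (Real.exp (-π * u ^ 2) : ℂ) * (u : ℂ) ^ (2 - ρ) := by
    rw [← integral_Ioc_eq_integral_Ioo, ← setIntegral_union (Set.Ioc_disjoint_Ioi le_rfl)
      measurableSet_Ioi (hint.mono_set Set.Ioc_subset_Ioi_self)
      (hint.mono_set (Set.Ioi_subset_Ioi hA.le)), Set.Ioc_union_Ioi_eq_Ioi hA.le]
  have hcast : (l : ℂ) + 1 / 2 = (((l : ℝ) + 1 / 2 : ℝ) : ℂ) := by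
    push_cast
    rfl
  rw [delta_eq_integral_Ioo ρ hρ1 hx, integral_eta_mul_cpow ρ hρ1, hsplit, hcast,
    Complex.ofReal_div, Complex.div_cpow_ofReal_nonneg hL.le hx.le]
  field_simp
  ring
end

section
/- The function η is its own Fourier transform: for every real y, ∫_ℝ η(x)·e^{2πixy} dx = η(y). -/
open MeasureTheory Real Filter

/-- The Gaussian `e^{−πx²}` modulated by the character `e^{2πixy}`. -/
noncomputable def modulatedGaussian (y x : ℝ) : ℂ :=
  Complex.exp (-π * (x : ℂ) ^ 2 + 2 * π * x * y * Complex.I)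

lemma norm_modulatedGaussian (y x : ℝ) :
    ‖modulatedGaussian y x‖ = Real.exp (-π * x ^ 2) := by
  have h : (-π * (x : ℂ) ^ 2 + 2 * π * x * y * Complex.I)
      = ((-π * x ^ 2 : ℝ) : ℂ) + ((2 * π * x * y : ℝ) : ℂ) * Complex.I := by
    push_cast; ring
  rw [modulatedGaussian, h, Complex.norm_exp, Complex.add_re, Complex.ofReal_re,
    Complex.re_ofReal_mul, Complex.I_re, mul_zero, add_zero]

lemma integrable_pow_mul_modulatedGaussian (n : ℕ) (y : ℝ) :
    Integrable fun x : ℝ => (x : ℂ) ^ n * modulatedGaussian y x := by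
  have h := integrable_rpow_mul_exp_neg_mul_sq pi_pos (s := (n : ℝ))
    (by linarith [n.cast_nonneg (α := ℝ)])
  refine h.mono (Continuous.aestronglyMeasurable ?_) (ae_of_all _ fun x => ?_)
  · unfold modulatedGaussian
    fun_prop
  · simp [norm_modulatedGaussian, rpow_natCast]

lemma hasDerivAt_modulatedGaussian (y x : ℝ) :
    HasDerivAt (modulatedGaussian y)
      (modulatedGaussian y x * (-2 * π * x + 2 * π * y * Complex.I)) x := by
  have hx : HasDerivAt (fun x : ℝ => (x : ℂ)) 1 x := Complex.ofRealCLM.hasDerivAt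
  have h := (((hx.pow 2).const_mul (-π : ℂ)).add
    (((hx.const_mul (2 * π : ℂ)).mul_const (y : ℂ)).mul_const Complex.I)).cexp
  refine h.congr_deriv ?_
  change modulatedGaussian y x * _ = _
  push_cast
  ring

lemma integral_modulatedGaussian (y : ℝ) :
    ∫ x, modulatedGaussian y x = Complex.exp (-π * (y : ℂ) ^ 2) := by
  have h := fourierIntegral_gaussian (b := (π : ℂ)) (by simpa using pi_pos) (2 * π * y)
  have hpi : (π : ℂ) ≠ 0 := by exact_mod_cast pi_ne_zero
  rw [div_self hpi, Complex.one_cpow, one_mul] at h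
  convert h using 2
  · ext x
    rw [modulatedGaussian, ← Complex.exp_add]
    ring_nf
  · field_simp
    ring

lemma integral_pow_one_mul_modulatedGaussian (y : ℝ) :
    ∫ x : ℝ, (x : ℂ) ^ 1 * modulatedGaussian y x
      = y * Complex.I * ∫ x, modulatedGaussian y x := by
  have hpi : (π : ℂ) ≠ 0 := by exact_mod_cast pi_ne_zero
  have h₀ : Integrable (modulatedGaussian y) := by
    simpa using integrable_pow_mul_modulatedGaussian 0 y
  have h₁ := integrable_pow_mul_modulatedGaussian 1 y
  have hd : (fun x : ℝ => modulatedGaussian y x * (-2 * π * x + 2 * π * y * Complex.I))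
      = fun x : ℝ => -2 * π * ((x : ℂ) ^ 1 * modulatedGaussian y x)
        + 2 * π * y * Complex.I * modulatedGaussian y x := by
    ext x; ring
  have h := integral_eq_zero_of_hasDerivAt_of_integrable (hasDerivAt_modulatedGaussian y)
    (by rw [hd]; exact (h₁.const_mul _).add (h₀.const_mul _)) h₀
  rw [hd, integral_add (h₁.const_mul _) (h₀.const_mul _), integral_const_mul,
    integral_const_mul] at h
  apply mul_left_cancel₀ (mul_ne_zero two_ne_zero hpi)
  linear_combination -h

lemma integral_pow_add_two_mul_modulatedGaussian (n : ℕ) (y : ℝ) :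
    ∫ x : ℝ, (x : ℂ) ^ (n + 2) * modulatedGaussian y x
      = (n + 1) / (2 * π) * (∫ x : ℝ, (x : ℂ) ^ n * modulatedGaussian y x)
        + y * Complex.I * ∫ x : ℝ, (x : ℂ) ^ (n + 1) * modulatedGaussian y x := by
  have hpi : (π : ℂ) ≠ 0 := by exact_mod_cast pi_ne_zero
  have h₀ := integrable_pow_mul_modulatedGaussian n y
  have h₁ := integrable_pow_mul_modulatedGaussian (n + 1) y
  have h₂ := integrable_pow_mul_modulatedGaussian (n + 2) y
  have hderiv (x : ℝ) : HasDerivAt (fun x : ℝ => (x : ℂ) ^ (n + 1) * modulatedGaussian y x)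
      ((n + 1) * ((x : ℂ) ^ n * modulatedGaussian y x)
        + (-2 * π * ((x : ℂ) ^ (n + 2) * modulatedGaussian y x)
        + 2 * π * y * Complex.I * ((x : ℂ) ^ (n + 1) * modulatedGaussian y x))) x := by
    have hx : HasDerivAt (fun x : ℝ => (x : ℂ)) 1 x := Complex.ofRealCLM.hasDerivAt
    refine ((hx.pow (n + 1)).mul (hasDerivAt_modulatedGaussian y x)).congr_deriv ?_
    simp only [Pi.pow_apply, Nat.add_sub_cancel]
    push_cast
    ring
  have hi : Integrable fun x : ℝ => -2 * π * ((x : ℂ) ^ (n + 2) * modulatedGaussian y x)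
      + 2 * π * y * Complex.I * ((x : ℂ) ^ (n + 1) * modulatedGaussian y x) :=
    (h₂.const_mul _).add (h₁.const_mul _)
  have h := integral_eq_zero_of_hasDerivAt_of_integrable hderiv
    ((h₀.const_mul _).add hi) h₁
  rw [integral_add (h₀.const_mul _) hi, integral_add (h₂.const_mul _) (h₁.const_mul _),
    integral_const_mul, integral_const_mul, integral_const_mul] at h
  field_simp
  linear_combination -h

theorem stmt_5 (y : ℝ) :
    (∫ x : ℝ, (eta x : ℂ) * Complex.exp (((2 * π * x * y : ℝ) : ℂ) * Complex.I))
      = (eta y : ℂ) := by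
  have hpi : (π : ℂ) ≠ 0 := by exact_mod_cast pi_ne_zero
  have hfun : (fun x : ℝ =>
      (eta x : ℂ) * Complex.exp (((2 * π * x * y : ℝ) : ℂ) * Complex.I))
      = fun x : ℝ => 8 * π ^ 2 * ((x : ℂ) ^ 4 * modulatedGaussian y x)
        - 12 * π * ((x : ℂ) ^ 2 * modulatedGaussian y x) := by
    ext x
    rw [eta, modulatedGaussian, Complex.exp_add]
    push_cast
    ring
  have h₂ := integral_pow_add_two_mul_modulatedGaussian 0 y
  have h₃ := integral_pow_add_two_mul_modulatedGaussian 1 y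
  have h₄ := integral_pow_add_two_mul_modulatedGaussian 2 y
  simp only [zero_add, pow_zero, one_mul, Nat.reduceAdd] at h₂ h₃ h₄
  rw [hfun, integral_sub ((integrable_pow_mul_modulatedGaussian 4 y).const_mul _)
    ((integrable_pow_mul_modulatedGaussian 2 y).const_mul _), integral_const_mul,
    integral_const_mul, h₄, h₃, h₂, integral_pow_one_mul_modulatedGaussian,
    integral_modulatedGaussian, eta]
  push_cast
  field_simp
  ring_nf
  simp only [Complex.I_sq, Complex.I_pow_four]
  ring
end

section
/- For every nontrivial zero ρ of the Riemann zeta function and every real B > 0, ∫₀^B (∫₁^∞ η(t·u)·u^{−ρ} du) dt = −4π·B³·∫₁^∞ u^{2−ρ}·e^{−π(Bu)²} du = −4π·B^ρ·∫_B^∞ e^{−πu²}·u^{2−ρ} du. -/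
open MeasureTheory Real Filter

lemma hasDerivAt_eta_antideriv (x : ℝ) :
    HasDerivAt (fun x : ℝ => -4 * π * x ^ 3 * Real.exp (-π * x ^ 2)) (eta x) x := by
  have h1 : HasDerivAt (fun x : ℝ => -π * x ^ 2) (-π * (2 * x)) x := by
    simpa using (hasDerivAt_pow 2 x).const_mul (-π)
  have h2 : HasDerivAt (fun x : ℝ => -4 * π * x ^ 3) (-4 * π * (3 * x ^ 2)) x := by
    simpa using (hasDerivAt_pow 3 x).const_mul (-4 * π)
  refine (h2.mul h1.exp).congr_deriv ?_
  simp only [eta]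
  ring

lemma integral_eta_mul {u : ℝ} (hu : u ≠ 0) (B : ℝ) :
    ∫ t in (0 : ℝ)..B, eta (t * u) = -4 * π * B ^ 3 * u ^ 2 * Real.exp (-π * (B * u) ^ 2) := by
  rw [intervalIntegral.integral_comp_mul_right _ hu,
    intervalIntegral.integral_eq_sub_of_hasDerivAt (fun x _ => hasDerivAt_eta_antideriv x)
      (continuous_eta.intervalIntegrable _ _)]
  simp only [smul_eq_mul]
  field_simp
  ring_nf

lemma one_add_mul_abs_eta_le (x : ℝ) :
    (1 + x) * |eta x| ≤ 192 * Real.exp 1 := by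
  set y := π * x ^ 2 with hy
  have hxy : x ^ 2 ≤ y := by nlinarith [Real.pi_gt_three, sq_nonneg x]
  have hy0 : 0 ≤ y := by positivity
  have heta : |eta x| = 8 * y * |y - 3 / 2| * Real.exp (-y) := by
    have : eta x = 8 * y * (y - 3 / 2) * Real.exp (-y) := by simp only [eta, hy]; ring_nf
    rw [this, abs_mul, abs_mul, abs_of_nonneg (by positivity : 0 ≤ 8 * y), Real.abs_exp]
  have hexp : (1 + y) ^ 3 ≤ 6 * (Real.exp 1 * Real.exp y) := by
    have := Real.pow_div_factorial_le_exp (1 + y) (by positivity) 3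
    rw [Real.exp_add] at this
    norm_num [Nat.factorial] at this
    linarith
  have habs : |y - 3 / 2| ≤ 2 * (1 + y) := abs_le.2 ⟨by linarith, by linarith⟩
  have hx1 : 1 + x ≤ 2 * (1 + y) := by nlinarith [sq_nonneg (x - 1)]
  calc (1 + x) * |eta x| = (1 + x) * (8 * y * |y - 3 / 2| * Real.exp (-y)) := by rw [heta]
    _ ≤ (2 * (1 + y)) * (8 * (1 + y) * (2 * (1 + y)) * Real.exp (-y)) := by
      gcongr
      linarith
    _ = 32 * (1 + y) ^ 3 * Real.exp (-y) := by ring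
    _ ≤ 32 * (6 * (Real.exp 1 * Real.exp y)) * Real.exp (-y) := by gcongr
    _ = 192 * Real.exp 1 * (Real.exp y * Real.exp (-y)) := by ring
    _ = 192 * Real.exp 1 := by rw [← Real.exp_add]; simp

lemma abs_eta_le_rpow {x a : ℝ} (hx : 0 < x) (ha0 : 0 ≤ a) (ha1 : a ≤ 1) :
    |eta x| ≤ 192 * Real.exp 1 * x ^ (-a) := by
  have hle : x ^ a ≤ 1 + x := by
    rcases le_total x 1 with h | h
    · linarith [Real.rpow_le_one hx.le h ha0]
    · have := Real.rpow_le_rpow_of_exponent_le h ha1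
      rw [Real.rpow_one] at this
      linarith
  rw [Real.rpow_neg hx.le, ← div_eq_mul_inv, le_div_iff₀ (Real.rpow_pos_of_pos hx a), mul_comm]
  exact (mul_le_mul_of_nonneg_right hle (abs_nonneg _)).trans (one_add_mul_abs_eta_le x)

lemma integrable_eta_mul_cpow {ρ : ℂ} (hρ0 : 0 < ρ.re) (hρ1 : ρ.re < 1) (B : ℝ) :
    Integrable (fun p : ℝ × ℝ => (eta (p.1 * p.2) : ℂ) * (p.2 : ℂ) ^ (-ρ))
      ((volume.restrict (Set.Ioc 0 B)).prod (volume.restrict (Set.Ioi 1))) := by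
  set a : ℝ := 1 - ρ.re / 2 with ha
  have hint_t : Integrable (fun t : ℝ => t ^ (-a)) (volume.restrict (Set.Ioc 0 B)) :=
    (intervalIntegral.intervalIntegrable_rpow' (a := 0) (b := B) (by linarith)).1
  have hint_u : Integrable (fun u : ℝ => u ^ (-a - ρ.re)) (volume.restrict (Set.Ioi 1)) :=
    integrableOn_Ioi_rpow_of_lt (by linarith) one_pos
  refine ((hint_t.mul_prod hint_u).const_mul (192 * Real.exp 1)).mono' ?_ ?_
  · refine Measurable.aestronglyMeasurable ?_
    have := continuous_eta.measurable
    fun_prop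
  · rw [Measure.prod_restrict]
    filter_upwards [ae_restrict_mem (measurableSet_Ioc.prod measurableSet_Ioi)] with p hp
    obtain ⟨t, u⟩ := p
    obtain ⟨⟨ht, -⟩, hu⟩ := hp
    have ht : 0 < t := ht
    have hu : 0 < u := one_pos.trans hu
    simp only [norm_mul, Complex.norm_real, Real.norm_eq_abs,
      Complex.norm_cpow_eq_rpow_re_of_pos hu, Complex.neg_re]
    calc |eta (t * u)| * u ^ (-ρ.re)
        ≤ 192 * Real.exp 1 * (t * u) ^ (-a) * u ^ (-ρ.re) := by
          gcongr
          exact abs_eta_le_rpow (by positivity) (by linarith) (by linarith)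
      _ = 192 * Real.exp 1 * (t ^ (-a) * u ^ (-a - ρ.re)) := by
          rw [Real.mul_rpow ht.le hu.le, sub_eq_add_neg, Real.rpow_add hu]
          ring

lemma integral_Ioi_exp_mul_cpow (ρ : ℂ) {B : ℝ} (hB : 0 < B) :
    (B : ℂ) ^ 3 *
        ∫ u in Set.Ioi (1 : ℝ), (u : ℂ) ^ (2 - ρ) * (Real.exp (-π * (B * u) ^ 2) : ℂ)
      = (B : ℂ) ^ ρ *
        ∫ u in Set.Ioi B, (Real.exp (-π * u ^ 2) : ℂ) * (u : ℂ) ^ (2 - ρ) := by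
  have hB0 : (B : ℂ) ≠ 0 := by exact_mod_cast hB.ne'
  have hsub := integral_comp_mul_left_Ioi
    (fun u : ℝ => (Real.exp (-π * u ^ 2) : ℂ) * (u : ℂ) ^ (2 - ρ)) 1 hB
  rw [mul_one] at hsub
  have hpow : (B : ℂ) ^ ρ * (B : ℂ) ^ (2 - ρ) = (B : ℂ) ^ 2 := by
    rw [← Complex.cpow_add _ _ hB0, add_sub_cancel]
    norm_cast
  have hscale : ∫ u in Set.Ioi (1 : ℝ),
        (Real.exp (-π * (B * u) ^ 2) : ℂ) * ((B * u : ℝ) : ℂ) ^ (2 - ρ)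
      = (B : ℂ) ^ (2 - ρ) *
        ∫ u in Set.Ioi (1 : ℝ), (u : ℂ) ^ (2 - ρ) * (Real.exp (-π * (B * u) ^ 2) : ℂ) := by
    rw [← integral_const_mul]
    refine setIntegral_congr_fun measurableSet_Ioi fun u hu => ?_
    have hu : 0 < u := one_pos.trans hu
    simp only [Complex.ofReal_mul B u, Complex.mul_cpow_ofReal_nonneg hB.le hu.le]
    ring
  have hI : ∫ u in Set.Ioi B, (Real.exp (-π * u ^ 2) : ℂ) * (u : ℂ) ^ (2 - ρ)
      = (B : ℂ) * ((B : ℂ) ^ (2 - ρ) *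
        ∫ u in Set.Ioi (1 : ℝ), (u : ℂ) ^ (2 - ρ) * (Real.exp (-π * (B * u) ^ 2) : ℂ)) := by
    rw [← hscale, hsub, Complex.real_smul, Complex.ofReal_inv, mul_inv_cancel_left₀ hB0]
  rw [hI, mul_left_comm, ← mul_assoc ((B : ℂ) ^ ρ), hpow]
  ring

lemma integral_integral_eta_mul_cpow {ρ : ℂ} (hρ0 : 0 < ρ.re) (hρ1 : ρ.re < 1)
    {B : ℝ} (hB : 0 ≤ B) :
    (∫ t in (0 : ℝ)..B, ∫ u in Set.Ioi (1 : ℝ), (eta (t * u) : ℂ) * (u : ℂ) ^ (-ρ))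
      = -4 * (π : ℂ) * (B : ℂ) ^ 3 *
          ∫ u in Set.Ioi (1 : ℝ), (u : ℂ) ^ (2 - ρ) * (Real.exp (-π * (B * u) ^ 2) : ℂ) := by
  rw [intervalIntegral.integral_of_le hB,
    integral_integral_swap (integrable_eta_mul_cpow hρ0 hρ1 B), ← integral_const_mul]
  refine setIntegral_congr_fun measurableSet_Ioi fun u hu => ?_
  have hu : u ≠ 0 := (one_pos.trans hu).ne'
  have hu0 : (u : ℂ) ≠ 0 := by exact_mod_cast hu
  have hpow : (u : ℂ) ^ (2 - ρ) = (u : ℂ) ^ 2 * (u : ℂ) ^ (-ρ) := by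
    rw [sub_eq_add_neg, Complex.cpow_add _ _ hu0]
    norm_cast
  rw [integral_mul_const, integral_complex_ofReal, ← intervalIntegral.integral_of_le hB,
    integral_eta_mul hu, hpow]
  push_cast
  ring

theorem stmt_7 (ρ : ℂ) (hζ : riemannZeta ρ = 0) (hρ0 : 0 < ρ.re) (hρ1 : ρ.re < 1)
    (B : ℝ) (hB : 0 < B) :
    (∫ t in (0 : ℝ)..B, ∫ u in Set.Ioi (1 : ℝ), (eta (t * u) : ℂ) * (u : ℂ) ^ (-ρ))
        = -4 * (π : ℂ) * (B : ℂ) ^ 3 *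
            ∫ u in Set.Ioi (1 : ℝ), (u : ℂ) ^ (2 - ρ) * (Real.exp (-π * (B * u) ^ 2) : ℂ)
      ∧ (∫ t in (0 : ℝ)..B, ∫ u in Set.Ioi (1 : ℝ), (eta (t * u) : ℂ) * (u : ℂ) ^ (-ρ))
        = -4 * (π : ℂ) * (B : ℂ) ^ ρ *
            ∫ u in Set.Ioi B, (Real.exp (-π * u ^ 2) : ℂ) * (u : ℂ) ^ (2 - ρ) := by
  have h := integral_integral_eta_mul_cpow hρ0 hρ1 hB.le
  refine ⟨h, h.trans ?_⟩
  rw [mul_assoc, mul_assoc (-4 * (π : ℂ)), integral_Ioi_exp_mul_cpow ρ hB]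
end

section
/- For every complex number s with Re(s) > 0, the Mellin transform of η satisfies ∫₀^∞ η(t)·t^{s−1} dt = s(s−1)·π^{−s/2}·Γ(s/2). -/
open MeasureTheory Real Filter

/-- The Mellin transform of `t ↦ e^{-t}` is the Gamma function. -/
theorem hasMellin_exp_neg {s : ℂ} (hs : 0 < s.re) :
    HasMellin (fun t : ℝ => (Real.exp (-t) : ℂ)) s (Complex.Gamma s) := by
  refine ⟨?_, ?_⟩
  · refine (Complex.GammaIntegral_convergent hs).congr_fun (fun t _ => ?_) measurableSet_Ioi
    simp [mul_comm]
  · rw [Complex.Gamma_eq_integral hs, Complex.GammaIntegral_eq_mellin]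

/-- The Mellin transform of the Gaussian `t ↦ e^{-πt²}`. -/
theorem hasMellin_exp_neg_pi_mul_sq {s : ℂ} (hs : 0 < s.re) :
    HasMellin (fun t : ℝ => (Real.exp (-π * t ^ 2) : ℂ)) s
      ((π : ℂ) ^ (-s / 2) * Complex.Gamma (s / 2) / 2) := by
  have hs2 : 0 < (s / 2).re := by simpa using hs
  obtain ⟨hconv, heq⟩ := hasMellin_exp_neg hs2
  have hfun : (fun t : ℝ => (Real.exp (-π * t ^ 2) : ℂ)) =
      fun t : ℝ => (fun u : ℝ => (Real.exp (-(π * u)) : ℂ)) (t ^ (2 : ℝ)) := by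
    funext t
    simp
  rw [hfun]
  refine ⟨?_, ?_⟩
  · refine (MellinConvergent.comp_rpow (f := fun u : ℝ => (Real.exp (-(π * u)) : ℂ))
      two_ne_zero).2 ?_
    have h := (MellinConvergent.comp_mul_left (f := fun t : ℝ => (Real.exp (-t) : ℂ))
      (s := s / 2) pi_pos).2 hconv
    simpa using h
  · rw [mellin_comp_rpow (fun u : ℝ => (Real.exp (-(π * u)) : ℂ)) s 2,
      mellin_comp_mul_left (fun t : ℝ => (Real.exp (-t) : ℂ)) _ pi_pos]
    simp only [Complex.ofReal_ofNat, heq]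
    simp [neg_div]
    ring

theorem stmt_8 (s : ℂ) (hs : 0 < s.re) :
    ∫ t in Set.Ioi (0 : ℝ), (eta t : ℂ) * (t : ℂ) ^ (s - 1)
      = s * (s - 1) * (π : ℂ) ^ (-s / 2) * Complex.Gamma (s / 2) := by
  have hs2 : 0 < (s + 2).re := by simp; linarith
  have hs4 : 0 < (s + 4).re := by simp; linarith
  have hne : s ≠ 0 := fun h => by simp [h] at hs
  have hπ : (π : ℂ) ≠ 0 := Complex.ofReal_ne_zero.2 pi_ne_zero
  obtain ⟨hconv2, heq2⟩ := hasMellin_exp_neg_pi_mul_sq hs2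
  obtain ⟨hconv4, heq4⟩ := hasMellin_exp_neg_pi_mul_sq hs4
  have hsplit : ∀ t ∈ Set.Ioi (0 : ℝ), (eta t : ℂ) * (t : ℂ) ^ (s - 1) =
      8 * π ^ 2 * ((t : ℂ) ^ (s + 4 - 1) • (Real.exp (-π * t ^ 2) : ℂ)) -
        12 * π * ((t : ℂ) ^ (s + 2 - 1) • (Real.exp (-π * t ^ 2) : ℂ)) := by
    intro t ht
    have ht0 : (t : ℂ) ≠ 0 := Complex.ofReal_ne_zero.2 (ne_of_gt ht)
    have h2 : (t : ℂ) ^ (s + 2 - 1) = (t : ℂ) ^ (s - 1) * t ^ 2 := by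
      rw [show s + 2 - 1 = s - 1 + (2 : ℕ) by push_cast; ring, Complex.cpow_add _ _ ht0,
        Complex.cpow_natCast]
    have h4 : (t : ℂ) ^ (s + 4 - 1) = (t : ℂ) ^ (s - 1) * t ^ 4 := by
      rw [show s + 4 - 1 = s - 1 + (4 : ℕ) by push_cast; ring, Complex.cpow_add _ _ ht0,
        Complex.cpow_natCast]
    rw [h2, h4, eta, smul_eq_mul, smul_eq_mul]
    push_cast
    ring
  have hΓ2 : Complex.Gamma ((s + 2) / 2) = s / 2 * Complex.Gamma (s / 2) := by
    rw [show (s + 2) / 2 = s / 2 + 1 by ring,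
      Complex.Gamma_add_one _ (div_ne_zero hne two_ne_zero)]
  have hΓ4 : Complex.Gamma ((s + 4) / 2) =
      (s + 2) / 2 * (s / 2 * Complex.Gamma (s / 2)) := by
    rw [show (s + 4) / 2 = (s + 2) / 2 + 1 by ring, Complex.Gamma_add_one, hΓ2]
    exact div_ne_zero (fun h => by simp [h] at hs2) two_ne_zero
  have hp2 : (π : ℂ) ^ (-(s + 2) / 2) = (π : ℂ) ^ (-s / 2) / π := by
    rw [show -(s + 2) / 2 = -s / 2 - 1 by ring, Complex.cpow_sub _ _ hπ, Complex.cpow_one]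
  have hp4 : (π : ℂ) ^ (-(s + 4) / 2) = (π : ℂ) ^ (-s / 2) / π ^ 2 := by
    rw [show -(s + 4) / 2 = -s / 2 - (2 : ℕ) by push_cast; ring, Complex.cpow_sub _ _ hπ,
      Complex.cpow_natCast]
  rw [setIntegral_congr_fun measurableSet_Ioi hsplit,
    integral_sub (hconv4.const_mul _) (hconv2.const_mul _),
    integral_const_mul, integral_const_mul]
  rw [mellin] at heq2 heq4
  rw [heq2, heq4, hΓ2, hΓ4, hp2, hp4]
  field_simp
  ring
end

section
/- Let ρ be a nontrivial zero of the Riemann zeta function. For every complex number s with Re(s) > 1, the Mellin transform of F_ρ satisfies ∫₀^∞ F_ρ(x)·x^{s−1} dx = s(s−1)·π^{−s/2}·Γ(s/2)·ζ(s)/(s−ρ). -/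
open MeasureTheory Real Filter

theorem hasMellin_quadratic_mul_exp_neg {w : ℂ} (hw : 0 < w.re) :
    HasMellin (fun u : ℝ => ((8 * u * (u - 3 / 2) * Real.exp (-u) : ℝ) : ℂ)) w
      (4 * w * (2 * w - 1) * Complex.Gamma w) := by
  have conv {z : ℂ} (hz : 0 < z.re) : HasMellin (fun u : ℝ => ((Real.exp (-u) : ℝ) : ℂ)) z
      (Complex.Gamma z) := by
    refine ⟨?_, ?_⟩
    · refine (Complex.GammaIntegral_convergent hz).congr_fun (fun x _ => ?_) measurableSet_Ioi
      simp [mul_comm]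
    · rw [← Complex.GammaIntegral_eq_mellin, Complex.Gamma_eq_integral hz]
  have hw0 : w ≠ 0 := by rintro rfl; simp at hw
  have hw1 : w + 1 ≠ 0 := fun h => by
    have := congrArg Complex.re h
    simp at this
    linarith
  have c1 := conv (z := w + 1) (by simp; linarith)
  have c2 := conv (z := w + 2) (by simp; linarith)
  have c1' : HasMellin (fun u : ℝ => (u : ℂ) ^ (1 : ℂ) • ((Real.exp (-u) : ℝ) : ℂ)) w
      (Complex.Gamma (w + 1)) :=
    ⟨MellinConvergent.cpow_smul.2 c1.1, (mellin_cpow_smul _ _ _).trans c1.2⟩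
  have c2' : HasMellin (fun u : ℝ => (u : ℂ) ^ (2 : ℂ) • ((Real.exp (-u) : ℝ) : ℂ)) w
      (Complex.Gamma (w + 2)) :=
    ⟨MellinConvergent.cpow_smul.2 c2.1, (mellin_cpow_smul _ _ _).trans c2.2⟩
  have h := hasMellin_sub (c2'.1.const_smul (8 : ℂ)) (c1'.1.const_smul (12 : ℂ))
  rw [mellin_const_smul, mellin_const_smul, c1'.2, c2'.2, show w + 2 = w + 1 + 1 by ring,
    Complex.Gamma_add_one _ hw1, Complex.Gamma_add_one _ hw0] at h
  convert h using 1
  · ext u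
    have : (u : ℂ) ^ (2 : ℂ) = (u : ℂ) ^ 2 := by exact_mod_cast Complex.cpow_natCast (u : ℂ) 2
    rw [this, Complex.cpow_one]
    push_cast
    simp only [smul_eq_mul]
    ring
  · simp only [smul_eq_mul]
    ring

theorem hasMellin_eta {s : ℂ} (hs : 0 < s.re) :
    HasMellin (fun x : ℝ => (eta x : ℂ)) s
      (s * (s - 1) * (π : ℂ) ^ (-s / 2) * Complex.Gamma (s / 2)) := by
  have hs2 : 0 < (s / ((2 : ℝ) : ℂ)).re := by
    rw [Complex.div_ofReal_re]; linarith
  obtain ⟨hc, hv⟩ := hasMellin_quadratic_mul_exp_neg hs2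
  have heq (x : ℝ) : (eta x : ℂ) = (fun u : ℝ =>
      ((8 * u * (u - 3 / 2) * Real.exp (-u) : ℝ) : ℂ)) (π * x ^ (2 : ℝ)) := by
    simp only [eta, Real.rpow_two, neg_mul]
    ring_nf
  generalize (fun u : ℝ => ((8 * u * (u - 3 / 2) * Real.exp (-u) : ℝ) : ℂ)) = h at hc hv heq
  rw [funext heq]
  refine ⟨(MellinConvergent.comp_rpow (f := fun v => h (π * v)) two_ne_zero).2
    ((MellinConvergent.comp_mul_left Real.pi_pos).2 hc), ?_⟩
  rw [mellin_comp_rpow (fun v => h (π * v)), mellin_comp_mul_left _ _ Real.pi_pos, hv]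
  simp only [Complex.ofReal_ofNat, smul_eq_mul, Complex.real_smul, neg_div]
  norm_num
  ring

theorem measurable_eta : Measurable eta := by
  unfold eta
  fun_prop

theorem integral_norm_cpow_mul_comp_mul_left (f : ℝ → ℂ) (s : ℂ) {a : ℝ} (ha : 0 < a) :
    ∫ x in Set.Ioi (0 : ℝ), ‖(x : ℂ) ^ (s - 1) * f (a * x)‖
      = a ^ (-s.re) * ∫ x in Set.Ioi (0 : ℝ), ‖(x : ℂ) ^ (s - 1) * f x‖ := by
  have h : ∀ x ∈ Set.Ioi (0 : ℝ), ‖(x : ℂ) ^ (s - 1) * f (a * x)‖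
      = a ^ (1 - s.re) * (fun y : ℝ => ‖(y : ℂ) ^ (s - 1) * f y‖) (a * x) := by
    intro x hx
    have hx : 0 < x := hx
    simp only [norm_mul]
    rw [Complex.norm_cpow_eq_rpow_re_of_pos hx, Complex.norm_cpow_eq_rpow_re_of_pos (mul_pos ha hx),
      Real.mul_rpow ha.le hx.le, ← mul_assoc, ← mul_assoc, ← Real.rpow_add ha]
    simp
  rw [setIntegral_congr_fun measurableSet_Ioi h, integral_const_mul,
    integral_comp_mul_left_Ioi (fun y : ℝ => ‖(y : ℂ) ^ (s - 1) * f y‖) _ ha, mul_zero,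
    smul_eq_mul, ← mul_assoc, ← Real.rpow_neg_one, ← Real.rpow_add ha]
  ring_nf

theorem integrable_tsum_of_summable_integral_norm {α : Type*} [MeasurableSpace α] {μ : Measure α}
    {f : ℕ → α → ℂ} (hf : ∀ n, Integrable (f n) μ) (hm : ∀ n, Measurable (f n))
    (hs : Summable fun n => ∫ a, ‖f n a‖ ∂μ) : Integrable (fun a => ∑' n, f n a) μ := by
  refine ⟨(Measurable.tsum hm).aestronglyMeasurable, ?_⟩
  calc ∫⁻ a, ‖∑' n, f n a‖ₑ ∂μ ≤ ∫⁻ a, ∑' n, ‖f n a‖ₑ ∂μ :=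
        lintegral_mono fun a => enorm_tsum_le_tsum_enorm
    _ = ∑' n, ∫⁻ a, ‖f n a‖ₑ ∂μ := lintegral_tsum fun n => (hm n).enorm.aemeasurable
    _ = ∑' n, ENNReal.ofReal (∫ a, ‖f n a‖ ∂μ) := by
        simp_rw [ofReal_integral_norm_eq_lintegral_enorm (hf _)]
    _ < ⊤ := lt_top_iff_ne_top.2 hs.tsum_ofReal_ne_top

theorem HasMellin.tsum_comp_nat_add_one_mul {f : ℝ → ℂ} {s m : ℂ} (hf : HasMellin f s m)
    (hm : Measurable f) (hs : 1 < s.re) :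
    HasMellin (fun x : ℝ => ∑' n : ℕ, f (((n : ℝ) + 1) * x)) s (m * riemannZeta s) := by
  have hpos (n : ℕ) : 0 < (n : ℝ) + 1 := by positivity
  have hint (n : ℕ) : MellinConvergent (fun x => f (((n : ℝ) + 1) * x)) s :=
    (MellinConvergent.comp_mul_left (hpos n)).2 hf.1
  have hsum : Summable fun n : ℕ =>
      ∫ x in Set.Ioi (0 : ℝ), ‖(x : ℂ) ^ (s - 1) * f (((n : ℝ) + 1) * x)‖ := by
    simp_rw [fun n : ℕ => integral_norm_cpow_mul_comp_mul_left f s (hpos n)]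
    refine Summable.mul_right _ ?_
    refine ((Real.summable_one_div_nat_add_rpow 1 s.re).2 hs).congr fun n => ?_
    rw [abs_of_pos (hpos n), Real.rpow_neg (hpos n).le, one_div]
  simp only [MellinConvergent, smul_eq_mul] at hint
  refine ⟨?_, ?_⟩
  · simp only [MellinConvergent, smul_eq_mul, ← tsum_mul_left]
    exact integrable_tsum_of_summable_integral_norm hint (fun n => by fun_prop) hsum
  · simp only [mellin, smul_eq_mul, ← tsum_mul_left]
    rw [← integral_tsum_of_summable_integral_norm hint hsum,
      zeta_eq_tsum_one_div_nat_add_one_cpow hs, ← tsum_mul_left]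
    refine tsum_congr fun n => ?_
    have := mellin_comp_mul_left f s (hpos n)
    simp only [hf.2] at this
    simp only [mellin, smul_eq_mul] at this
    rw [this, Complex.cpow_neg]
    push_cast
    ring

theorem HasMellin.integral_Ioi_one {f : ℝ → ℂ} {s m ρ : ℂ} (hf : HasMellin f s m)
    (hm : Measurable f) (hs : ρ.re < s.re) :
    ∫ x in Set.Ioi (0 : ℝ),
      (∫ t in Set.Ioi (1 : ℝ), f (t * x) * (t : ℂ) ^ (ρ - 1)) * (x : ℂ) ^ (s - 1)
        = m / (s - ρ) := by
  simp_rw [← integral_mul_const]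
  have hpos {t : ℝ} (ht : t ∈ Set.Ioi (1 : ℝ)) : 0 < t := zero_lt_one.trans ht
  have hnorm : ∀ t ∈ Set.Ioi (1 : ℝ),
      ∫ x in Set.Ioi (0 : ℝ), ‖f (t * x) * (t : ℂ) ^ (ρ - 1) * (x : ℂ) ^ (s - 1)‖
        = t ^ (ρ.re - 1 - s.re) * ∫ x in Set.Ioi (0 : ℝ), ‖(x : ℂ) ^ (s - 1) * f x‖ := by
    intro t ht
    have h (x : ℝ) : ‖f (t * x) * (t : ℂ) ^ (ρ - 1) * (x : ℂ) ^ (s - 1)‖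
        = t ^ (ρ.re - 1) * ‖(x : ℂ) ^ (s - 1) * f (t * x)‖ := by
      simp only [norm_mul]
      rw [Complex.norm_cpow_eq_rpow_re_of_pos (hpos ht)]
      simp only [Complex.sub_re, Complex.one_re]
      ring
    simp_rw [h]
    rw [integral_const_mul, integral_norm_cpow_mul_comp_mul_left f s (hpos ht), ← mul_assoc,
      ← Real.rpow_add (hpos ht), ← sub_eq_add_neg]
  have hprod : Integrable (Function.uncurry fun x t : ℝ =>
      f (t * x) * (t : ℂ) ^ (ρ - 1) * (x : ℂ) ^ (s - 1))
      ((volume.restrict (Set.Ioi 0)).prod (volume.restrict (Set.Ioi 1))) := by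
    rw [integrable_prod_iff' (by
      refine Measurable.aestronglyMeasurable ?_
      simp only [Function.uncurry_def]
      fun_prop)]
    refine ⟨?_, ?_⟩
    · filter_upwards [ae_restrict_mem measurableSet_Ioi] with t ht
      have := (MellinConvergent.comp_mul_left (hpos ht)).2 hf.1
      refine (Integrable.mul_const this ((t : ℂ) ^ (ρ - 1))).congr (ae_of_all _ fun x => ?_)
      simp only [smul_eq_mul, Function.uncurry_apply_pair]
      ring
    · refine IntegrableOn.congr_fun ?_ (fun t ht => (hnorm t ht).symm) measurableSet_Ioi
      exact (integrableOn_Ioi_rpow_of_lt (by linarith) zero_lt_one).mul_const _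
  rw [integral_integral_swap hprod]
  have hinner : ∀ t ∈ Set.Ioi (1 : ℝ),
      ∫ x in Set.Ioi (0 : ℝ), f (t * x) * (t : ℂ) ^ (ρ - 1) * (x : ℂ) ^ (s - 1)
        = (t : ℂ) ^ (ρ - 1 - s) * m := by
    intro t ht
    have h := mellin_comp_mul_left f s (hpos ht)
    rw [hf.2] at h
    simp only [mellin, smul_eq_mul] at h
    rw [sub_eq_add_neg (ρ - 1) s, Complex.cpow_add _ _ (by exact_mod_cast (hpos ht).ne'),
      mul_assoc, ← h, ← integral_const_mul]
    congr 1 with x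
    ring
  have hne : s - ρ ≠ 0 := fun h => by
    have := congrArg Complex.re h
    simp at this
    linarith
  rw [setIntegral_congr_fun measurableSet_Ioi hinner, integral_mul_const,
    integral_Ioi_cpow_of_lt (by simp; linarith) zero_lt_one,
    show ρ - 1 - s + 1 = -(s - ρ) by ring]
  simp only [Complex.ofReal_one, Complex.one_cpow]
  field_simp

theorem stmt_9 (ρ : ℂ) (hζ : riemannZeta ρ = 0) (hρ0 : 0 < ρ.re) (hρ1 : ρ.re < 1)
    (s : ℂ) (hs : 1 < s.re) :
    ∫ x in Set.Ioi (0 : ℝ), F ρ x * (x : ℂ) ^ (s - 1)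
      = s * (s - 1) * (π : ℂ) ^ (-s / 2) * Complex.Gamma (s / 2) * riemannZeta s / (s - ρ) := by
  have hη : Measurable fun x : ℝ => (eta x : ℂ) := Complex.measurable_ofReal.comp measurable_eta
  have hG := (hasMellin_eta (zero_lt_one.trans hs)).tsum_comp_nat_add_one_mul hη hs
  have h := hG.integral_Ioi_one
    (Measurable.tsum fun n => hη.comp (measurable_const_mul ((n : ℝ) + 1))) (hρ1.trans hs)
  simpa only [F, mul_assoc] using h
end

section
/- Let ρ be a nontrivial zero of the Riemann zeta function with Re(ρ) < 1/2. Then there exists a constant C > 0 such that for every positive integer l, ∫₀^∞ |Σ_{m=1}^∞ ∫_{−1/2}^{1/2} (g_ρ(t·x + m·x) − g_ρ(m·x))·sin((2l+1)πt)/sin(πt) dt|² dx ≤ C/(2l+1)⁴. -/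
open MeasureTheory Real Filter
open scoped ENNReal NNReal

/-- The weighted average `∫₀¹ sᵏ f(st) ds` of `f` along the segment from `0` to `t`. -/
noncomputable def radialAverage (k : ℕ) (f : ℝ → ℂ) (t : ℝ) : ℂ :=
  ∫ s in (0 : ℝ)..1, (s : ℂ) ^ k * f (s * t)

lemma abs_mul_lt_of_mem_uIcc {s t r : ℝ} (hs : s ∈ Set.uIcc (0 : ℝ) 1) (ht : |t| < r) :
    |s * t| < r := by
  rw [Set.uIcc_of_le zero_le_one] at hs
  rw [abs_mul, abs_of_nonneg hs.1]
  nlinarith [hs.2, abs_nonneg t, hs.1]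

lemma continuousOn_radial {f : ℝ → ℂ} {r : ℝ} (hf : ∀ t, |t| < r → ContinuousAt f t) (k : ℕ)
    {t : ℝ} (ht : |t| < r) :
    ContinuousOn (fun s : ℝ => (s : ℂ) ^ k * f (s * t)) (Set.uIcc 0 1) := by
  intro s hs
  have h : ContinuousAt (fun s : ℝ => f (s * t)) s :=
    ContinuousAt.comp (f := fun s : ℝ => s * t) (hf _ (abs_mul_lt_of_mem_uIcc hs ht)) (by fun_prop)
  exact (ContinuousAt.mul (by fun_prop) h).continuousWithinAt

lemma aestronglyMeasurable_radial {f : ℝ → ℂ} {r : ℝ} (hf : ∀ t, |t| < r → ContinuousAt f t)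
    (k : ℕ) {t : ℝ} (ht : |t| < r) :
    AEStronglyMeasurable (fun s : ℝ => (s : ℂ) ^ k * f (s * t))
      (volume.restrict (Set.uIoc 0 1)) :=
  ((continuousOn_radial hf k ht).mono Set.uIoc_subset_uIcc).aestronglyMeasurable
    measurableSet_uIoc

lemma eventually_abs_lt {t r : ℝ} (ht : |t| < r) : ∀ᶠ x in nhds t, |x| < r :=
  continuous_abs.continuousAt.eventually_lt continuousAt_const ht

lemma norm_radial_le {f : ℝ → ℂ} {r M : ℝ} (hM : ∀ t, |t| < r → ‖f t‖ ≤ M) (k : ℕ)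
    {s t : ℝ} (hs : s ∈ Set.uIcc (0 : ℝ) 1) (ht : |t| < r) :
    ‖(s : ℂ) ^ k * f (s * t)‖ ≤ M := by
  have h := hM _ (abs_mul_lt_of_mem_uIcc hs ht)
  rw [Set.uIcc_of_le zero_le_one] at hs
  rw [norm_mul, norm_pow, Complex.norm_real, Real.norm_of_nonneg hs.1]
  exact (mul_le_of_le_one_left (norm_nonneg _) (pow_le_one₀ hs.1 hs.2)).trans h

lemma norm_radialAverage_le {f : ℝ → ℂ} {r M : ℝ} (hM : ∀ t, |t| < r → ‖f t‖ ≤ M) (k : ℕ)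
    {t : ℝ} (ht : |t| < r) : ‖radialAverage k f t‖ ≤ M := by
  have := intervalIntegral.norm_integral_le_of_norm_le_const
    (fun s hs => norm_radial_le hM k (Set.uIoc_subset_uIcc hs) ht)
  simpa [radialAverage] using this

lemma continuousAt_radialAverage {f : ℝ → ℂ} {r M : ℝ} (hf : ∀ t, |t| < r → ContinuousAt f t)
    (hM : ∀ t, |t| < r → ‖f t‖ ≤ M) (k : ℕ) {t : ℝ} (ht : |t| < r) :
    ContinuousAt (radialAverage k f) t := by
  refine intervalIntegral.continuousAt_of_dominated_interval (bound := fun _ => M) ?_ ?_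
    (by simp) ?_
  · filter_upwards [eventually_abs_lt ht] with x hx using aestronglyMeasurable_radial hf k hx
  · filter_upwards [eventually_abs_lt ht] with x hx
    exact .of_forall fun s hs => norm_radial_le hM k (Set.uIoc_subset_uIcc hs) hx
  · refine .of_forall fun s hs => continuousAt_const.mul ?_
    exact ContinuousAt.comp (f := fun t : ℝ => s * t)
      (hf _ (abs_mul_lt_of_mem_uIcc (Set.uIoc_subset_uIcc hs) ht)) (by fun_prop)

lemma hasDerivAt_radialAverage {f f' : ℝ → ℂ} {r M : ℝ}
    (hf : ∀ t, |t| < r → HasDerivAt f (f' t) t) (hf' : ∀ t, |t| < r → ContinuousAt f' t)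
    (hM : ∀ t, |t| < r → ‖f' t‖ ≤ M) (k : ℕ) {t : ℝ} (ht : |t| < r) :
    HasDerivAt (radialAverage k f) (radialAverage (k + 1) f' t) t := by
  have hc : ∀ t, |t| < r → ContinuousAt f t := fun t ht => (hf t ht).continuousAt
  refine (intervalIntegral.hasDerivAt_integral_of_dominated_loc_of_deriv_le
    (F := fun t s => (s : ℂ) ^ k * f (s * t)) (F' := fun t s => (s : ℂ) ^ (k + 1) * f' (s * t))
    (bound := fun _ => M) (eventually_abs_lt ht) ?_ ?_
    (aestronglyMeasurable_radial hf' (k + 1) ht) ?_ (by simp) ?_).2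
  · filter_upwards [eventually_abs_lt ht] with x hx using aestronglyMeasurable_radial hc k hx
  · exact (continuousOn_radial hc k ht).intervalIntegrable
  · exact .of_forall fun s hs x hx => norm_radial_le hM (k + 1) (Set.uIoc_subset_uIcc hs) hx
  · refine .of_forall fun s hs x hx => ?_
    have h := (hf _ (abs_mul_lt_of_mem_uIcc (Set.uIoc_subset_uIcc hs) hx)).scomp x
      ((hasDerivAt_id x).const_mul s)
    refine HasDerivAt.congr_deriv (h.const_mul ((s : ℂ) ^ k)) ?_
    simp [pow_succ, mul_assoc]

lemma mul_radialAverage_eq_sub {f f' : ℝ → ℂ} {r : ℝ}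
    (hf : ∀ t, |t| < r → HasDerivAt f (f' t) t) (hf' : ∀ t, |t| < r → ContinuousAt f' t)
    {t : ℝ} (ht : |t| < r) : (t : ℂ) * radialAverage 0 f' t = f t - f 0 := by
  have h := intervalIntegral.integral_eq_sub_of_hasDerivAt (a := 0) (b := 1)
    (f := fun s : ℝ => f (s * t)) (f' := fun s => (t : ℂ) * ((s : ℂ) ^ 0 * f' (s * t))) ?_ ?_
  · simpa [radialAverage] using h
  · intro s hs
    have h := (hf _ (abs_mul_lt_of_mem_uIcc hs ht)).scomp s ((hasDerivAt_id s).mul_const t)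
    refine HasDerivAt.congr_deriv (h) ?_
    simp
  · exact (continuousOn_const.mul (continuousOn_radial hf' 0 ht)).intervalIntegrable

/-- The function `t / sin (π t)` extends to a twice continuously differentiable function on
`[-1/2, 1/2]`. -/
lemma exists_smooth_div_sin : ∃ (p p' p'' : ℝ → ℂ) (K : ℝ),
    (∀ t ∈ Set.Icc (-(1 / 2) : ℝ) (1 / 2), p t * (Real.sin (π * t) : ℂ) = t) ∧
    (∀ t ∈ Set.Icc (-(1 / 2) : ℝ) (1 / 2), HasDerivAt p (p' t) t) ∧
    (∀ t ∈ Set.Icc (-(1 / 2) : ℝ) (1 / 2), HasDerivAt p' (p'' t) t) ∧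
    ContinuousOn p'' (Set.Icc (-(1 / 2) : ℝ) (1 / 2)) ∧
    (∀ t ∈ Set.Icc (-(1 / 2) : ℝ) (1 / 2), ‖p t‖ ≤ K ∧ ‖p' t‖ ≤ K ∧ ‖p'' t‖ ≤ K) := by
  let f₁ : ℝ → ℂ := fun t => (π * Real.cos (π * t) : ℝ)
  let f₂ : ℝ → ℂ := fun t => (-π ^ 2 * Real.sin (π * t) : ℝ)
  let f₃ : ℝ → ℂ := fun t => (-π ^ 3 * Real.cos (π * t) : ℝ)
  have hlin (t : ℝ) : HasDerivAt (fun t : ℝ => π * t) π t := by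
    simpa using (hasDerivAt_id t).const_mul π
  have d₀ (t : ℝ) : HasDerivAt (fun t : ℝ => ((Real.sin (π * t) : ℝ) : ℂ)) (f₁ t) t := by
    refine HasDerivAt.congr_deriv (((Real.hasDerivAt_sin _).comp t (hlin t)).ofReal_comp) ?_
    simp [f₁, mul_comm]
  have d₁ (t : ℝ) : HasDerivAt f₁ (f₂ t) t := by
    refine HasDerivAt.congr_deriv
      ((((Real.hasDerivAt_cos _).comp t (hlin t)).const_mul π).ofReal_comp) ?_
    simp only [f₂]; push_cast; ring
  have d₂ (t : ℝ) : HasDerivAt f₂ (f₃ t) t := by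
    refine HasDerivAt.congr_deriv
      ((((Real.hasDerivAt_sin _).comp t (hlin t)).const_mul (-π ^ 2)).ofReal_comp) ?_
    simp only [f₃]; push_cast; ring
  have c₃ : Continuous f₃ := by fun_prop
  have b₂ (t : ℝ) : ‖f₂ t‖ ≤ π ^ 2 := by
    simp only [f₂, Complex.norm_real, norm_mul, norm_neg, norm_pow, Real.norm_eq_abs, sq_abs]
    exact mul_le_of_le_one_right (by positivity) (Real.abs_sin_le_one _)
  have b₃ (t : ℝ) : ‖f₃ t‖ ≤ π ^ 3 := by
    simp only [f₃, Complex.norm_real, norm_mul, norm_neg, norm_pow, Real.norm_eq_abs,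
      abs_of_pos Real.pi_pos]
    exact mul_le_of_le_one_right (by positivity) (Real.abs_cos_le_one _)
  have hlt {t : ℝ} (ht : t ∈ Set.Icc (-(1 / 2) : ℝ) (1 / 2)) : |t| < 1 := by
    rw [abs_lt]; constructor <;> linarith [ht.1, ht.2]
  set S := radialAverage 0 f₁ with hS
  set S₁ := radialAverage 1 f₂
  set S₂ := radialAverage 2 f₃
  have e₀ {t : ℝ} (ht : t ∈ Set.Icc (-(1 / 2) : ℝ) (1 / 2)) :
      (t : ℂ) * S t = (Real.sin (π * t) : ℂ) := by
    have := mul_radialAverage_eq_sub (r := 1) (fun t _ => d₀ t) (fun t _ => (d₁ t).continuousAt)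
      (hlt ht)
    simpa using this
  have e₁ {t : ℝ} (ht : t ∈ Set.Icc (-(1 / 2) : ℝ) (1 / 2)) : HasDerivAt S (S₁ t) t :=
    hasDerivAt_radialAverage (fun t _ => d₁ t) (fun t _ => (d₂ t).continuousAt)
      (fun t _ => b₂ t) 0 (hlt ht)
  have e₂ {t : ℝ} (ht : t ∈ Set.Icc (-(1 / 2) : ℝ) (1 / 2)) : HasDerivAt S₁ (S₂ t) t :=
    hasDerivAt_radialAverage (fun t _ => d₂ t) (fun t _ => c₃.continuousAt)
      (fun t _ => b₃ t) 1 (hlt ht)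
  have e₃ {t : ℝ} (ht : t ∈ Set.Icc (-(1 / 2) : ℝ) (1 / 2)) : ContinuousAt S₂ t :=
    continuousAt_radialAverage (fun t _ => c₃.continuousAt) (fun t _ => b₃ t) 2 (hlt ht)
  have ne {t : ℝ} (ht : t ∈ Set.Icc (-(1 / 2) : ℝ) (1 / 2)) : S t ≠ 0 := by
    rcases eq_or_ne t 0 with rfl | h0
    · simp [hS, radialAverage, f₁, Real.pi_ne_zero]
    · intro h
      have h1 := e₀ ht
      rw [h, mul_zero, eq_comm, Complex.ofReal_eq_zero, Real.sin_eq_zero_iff_of_lt_of_lt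
        (by nlinarith [Real.pi_pos, ht.1]) (by nlinarith [Real.pi_pos, ht.2])] at h1
      simp [Real.pi_ne_zero, h0] at h1
  have hp {t : ℝ} (ht : t ∈ Set.Icc (-(1 / 2) : ℝ) (1 / 2)) :
      HasDerivAt (fun t => (S t)⁻¹) (-S₁ t / S t ^ 2) t := (e₁ ht).inv (ne ht)
  have hp' {t : ℝ} (ht : t ∈ Set.Icc (-(1 / 2) : ℝ) (1 / 2)) :
      HasDerivAt (fun t => -S₁ t / S t ^ 2)
        ((-S₂ t * S t ^ 2 - -S₁ t * (2 * S t * S₁ t)) / (S t ^ 2) ^ 2) t := by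
    refine HasDerivAt.congr_deriv ((e₂ ht).neg.div ((e₁ ht).pow 2) (pow_ne_zero 2 (ne ht))) ?_
    simp
  have cp'' : ContinuousOn
      (fun t => (-S₂ t * S t ^ 2 - -S₁ t * (2 * S t * S₁ t)) / (S t ^ 2) ^ 2)
      (Set.Icc (-(1 / 2) : ℝ) (1 / 2)) := by
    have c₀ : ContinuousOn S (Set.Icc (-(1 / 2) : ℝ) (1 / 2)) :=
      fun t ht => (e₁ ht).continuousAt.continuousWithinAt
    have c₁ : ContinuousOn S₁ (Set.Icc (-(1 / 2) : ℝ) (1 / 2)) :=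
      fun t ht => (e₂ ht).continuousAt.continuousWithinAt
    have c₂ : ContinuousOn S₂ (Set.Icc (-(1 / 2) : ℝ) (1 / 2)) :=
      fun t ht => (e₃ ht).continuousWithinAt
    exact ((c₂.neg.mul (c₀.pow 2)).sub (c₁.neg.mul ((continuousOn_const.mul c₀).mul c₁))).div
      ((c₀.pow 2).pow 2) fun t ht => pow_ne_zero 2 (pow_ne_zero 2 (ne ht))
  obtain ⟨K₀, h₀⟩ := isCompact_Icc.exists_bound_of_continuousOn
    (fun t ht => (hp ht).continuousAt.continuousWithinAt)
  obtain ⟨K₁, h₁⟩ := isCompact_Icc.exists_bound_of_continuousOn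
    (fun t ht => (hp' ht).continuousAt.continuousWithinAt)
  obtain ⟨K₂, h₂⟩ := isCompact_Icc.exists_bound_of_continuousOn cp''
  refine ⟨_, _, _, max K₀ (max K₁ K₂), ?_, fun t ht => hp ht, fun t ht => hp' ht, cp'',
    fun t ht => ⟨(h₀ t ht).trans (by simp), (h₁ t ht).trans (by simp),
      (h₂ t ht).trans (by simp)⟩⟩
  intro t ht
  rw [← e₀ ht]
  field_simp [ne ht]

/-- Two integrations by parts against an odd-frequency sine. -/
lemma norm_integral_mul_sin_le {h h' h'' : ℝ → ℂ} {B : ℝ}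
    (d : ∀ t ∈ Set.Icc (-(1 / 2) : ℝ) (1 / 2), HasDerivAt h (h' t) t)
    (d' : ∀ t ∈ Set.Icc (-(1 / 2) : ℝ) (1 / 2), HasDerivAt h' (h'' t) t)
    (c : ContinuousOn h'' (Set.Icc (-(1 / 2) : ℝ) (1 / 2)))
    (b' : ∀ t ∈ Set.Icc (-(1 / 2) : ℝ) (1 / 2), ‖h' t‖ ≤ B)
    (b'' : ∀ t ∈ Set.Icc (-(1 / 2) : ℝ) (1 / 2), ‖h'' t‖ ≤ B) (l : ℕ) :
    ‖∫ t in (-(1 / 2) : ℝ)..(1 / 2), h t * ((Real.sin ((2 * (l : ℝ) + 1) * π * t) : ℝ) : ℂ)‖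
      ≤ 3 * B / (2 * l + 1) ^ 2 := by
  set ω : ℝ := (2 * (l : ℝ) + 1) * π with hω
  have hω0 : 0 < ω := by positivity
  have hu : Set.uIcc (-(1 / 2) : ℝ) (1 / 2) = Set.Icc (-(1 / 2) : ℝ) (1 / 2) :=
    Set.uIcc_of_le (by norm_num)
  have hlin (t : ℝ) : HasDerivAt (fun t : ℝ => ω * t) ω t := by
    simpa using (hasDerivAt_id t).const_mul ω
  have dc (t : ℝ) : HasDerivAt (fun t : ℝ => ((-(Real.cos (ω * t)) / ω : ℝ) : ℂ))
      ((Real.sin (ω * t) : ℝ) : ℂ) t := by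
    refine HasDerivAt.ofReal_comp ?_
    refine HasDerivAt.congr_deriv (((Real.hasDerivAt_cos _).comp t (hlin t)).neg.div_const ω) ?_
    field_simp
  have ds (t : ℝ) : HasDerivAt (fun t : ℝ => ((-(Real.sin (ω * t)) / ω ^ 2 : ℝ) : ℂ))
      ((-(Real.cos (ω * t)) / ω : ℝ) : ℂ) t := by
    refine HasDerivAt.ofReal_comp ?_
    refine HasDerivAt.congr_deriv
      (((Real.hasDerivAt_sin _).comp t (hlin t)).neg.div_const (ω ^ 2)) ?_
    field_simp
  have hcos : Real.cos (ω * (1 / 2)) = 0 := by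
    rw [Real.cos_eq_zero_iff]
    exact ⟨l, by rw [hω]; push_cast; ring⟩
  have hcos' : Real.cos (ω * (-(1 / 2))) = 0 := by rw [mul_neg, Real.cos_neg, hcos]
  have i₁ := intervalIntegral.integral_mul_deriv_eq_deriv_mul (a := -(1 / 2)) (b := 1 / 2)
    (u := h) (u' := h') (fun t ht => d t (hu ▸ ht)) (fun t _ => dc t)
    (ContinuousOn.intervalIntegrable
      (fun t ht => (d' t (hu ▸ ht)).continuousAt.continuousWithinAt))
    (Continuous.intervalIntegrable (by fun_prop) _ _)
  have i₂ := intervalIntegral.integral_mul_deriv_eq_deriv_mul (a := -(1 / 2)) (b := 1 / 2)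
    (u := h') (u' := h'') (fun t ht => d' t (hu ▸ ht)) (fun t _ => ds t)
    (ContinuousOn.intervalIntegrable (hu ▸ c))
    (Continuous.intervalIntegrable (by fun_prop) _ _)
  rw [i₁, i₂, hcos, hcos']
  have hs (t : ℝ) : ‖((-(Real.sin (ω * t)) / ω ^ 2 : ℝ) : ℂ)‖ ≤ 1 / ω ^ 2 := by
    rw [Complex.norm_real, norm_div, norm_neg, Real.norm_eq_abs, Real.norm_eq_abs,
      abs_of_pos (pow_pos hω0 2)]
    gcongr
    exact Real.abs_sin_le_one _
  have hB : 0 ≤ B := (norm_nonneg _).trans (b' 0 (by norm_num))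
  have n₁ := mul_le_mul (b' (1 / 2) (by norm_num)) (hs (1 / 2)) (norm_nonneg _) hB
  have n₂ := mul_le_mul (b' (-(1 / 2)) (by norm_num)) (hs (-(1 / 2))) (norm_nonneg _) hB
  have n₃ : ‖∫ t in (-(1 / 2) : ℝ)..(1 / 2), h'' t * ((-(Real.sin (ω * t)) / ω ^ 2 : ℝ) : ℂ)‖
      ≤ B * (1 / ω ^ 2) := by
    have := intervalIntegral.norm_integral_le_of_norm_le_const (a := -(1 / 2)) (b := 1 / 2)
      (f := fun t => h'' t * ((-(Real.sin (ω * t)) / ω ^ 2 : ℝ) : ℂ)) (C := B * (1 / ω ^ 2)) ?_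
    · norm_num at this ⊢
      exact this
    · intro t ht
      rw [norm_mul]
      exact mul_le_mul (b'' t (hu ▸ Set.uIoc_subset_uIcc ht)) (hs t) (norm_nonneg _) hB
  rw [← norm_mul] at n₁ n₂
  have hω2 : 1 / ω ^ 2 ≤ 1 / (2 * l + 1) ^ 2 := by
    gcongr
    rw [hω]
    exact le_mul_of_one_le_right (by positivity) (by linarith [Real.pi_gt_three])
  simp only [neg_zero, zero_div, Complex.ofReal_zero, mul_zero, sub_self, zero_sub, norm_neg]
  calc _ ≤ _ := norm_sub_le_of_le (norm_sub_le_of_le n₁ n₂) n₃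
    _ = 3 * B * (1 / ω ^ 2) := by ring
    _ ≤ 3 * B * (1 / (2 * l + 1) ^ 2) := by gcongr
    _ = _ := by ring

/-- Quantitative localization for the Dirichlet kernel: the integral of `G t - G 0` against it
is `O((2l+1)⁻²)`, with a constant proportional to a bound for the first three derivatives. -/
lemma exists_norm_integral_dirichlet_le : ∃ K : ℝ, 0 < K ∧ ∀ (G G₁ G₂ G₃ : ℝ → ℂ) (M : ℝ),
    (∀ t, |t| < 3 / 4 → HasDerivAt G (G₁ t) t) → (∀ t, |t| < 3 / 4 → HasDerivAt G₁ (G₂ t) t) →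
    (∀ t, |t| < 3 / 4 → HasDerivAt G₂ (G₃ t) t) → (∀ t, |t| < 3 / 4 → ContinuousAt G₃ t) →
    (∀ t, |t| < 3 / 4 → ‖G₁ t‖ ≤ M) → (∀ t, |t| < 3 / 4 → ‖G₂ t‖ ≤ M) →
    (∀ t, |t| < 3 / 4 → ‖G₃ t‖ ≤ M) → ∀ l : ℕ,
    ‖∫ t in (-(1 / 2) : ℝ)..(1 / 2), (G t - G 0) *
      ((Real.sin ((2 * (l : ℝ) + 1) * π * t) / Real.sin (π * t) : ℝ) : ℂ)‖
      ≤ K * M / (2 * l + 1) ^ 2 := by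
  obtain ⟨p, p', p'', K, hp, dp, dp', cp'', bp⟩ := exists_smooth_div_sin
  have hK : 0 ≤ K := (norm_nonneg _).trans (bp 0 (by norm_num)).1
  refine ⟨12 * K + 1, by positivity, ?_⟩
  intro G G₁ G₂ G₃ M d₀ d₁ d₂ c₃ b₁ b₂ b₃ l
  have hM : 0 ≤ M := (norm_nonneg _).trans (b₁ 0 (by norm_num))
  have hlt {t : ℝ} (ht : t ∈ Set.Icc (-(1 / 2) : ℝ) (1 / 2)) : |t| < 3 / 4 := by
    rw [abs_lt]; constructor <;> linarith [ht.1, ht.2]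
  set q := radialAverage 0 G₁
  set q' := radialAverage 1 G₂
  set q'' := radialAverage 2 G₃
  have dq {t : ℝ} (ht : t ∈ Set.Icc (-(1 / 2) : ℝ) (1 / 2)) : HasDerivAt q (q' t) t :=
    hasDerivAt_radialAverage d₁ (fun t ht => (d₂ t ht).continuousAt) b₂ 0 (hlt ht)
  have dq' {t : ℝ} (ht : t ∈ Set.Icc (-(1 / 2) : ℝ) (1 / 2)) : HasDerivAt q' (q'' t) t :=
    hasDerivAt_radialAverage d₂ c₃ b₃ 1 (hlt ht)
  have cq'' : ContinuousOn q'' (Set.Icc (-(1 / 2) : ℝ) (1 / 2)) := fun t ht =>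
    (continuousAt_radialAverage c₃ b₃ 2 (hlt ht)).continuousWithinAt
  have bq {t : ℝ} (ht : t ∈ Set.Icc (-(1 / 2) : ℝ) (1 / 2)) : ‖q t‖ ≤ M :=
    norm_radialAverage_le b₁ 0 (hlt ht)
  have bq' {t : ℝ} (ht : t ∈ Set.Icc (-(1 / 2) : ℝ) (1 / 2)) : ‖q' t‖ ≤ M :=
    norm_radialAverage_le b₂ 1 (hlt ht)
  have bq'' {t : ℝ} (ht : t ∈ Set.Icc (-(1 / 2) : ℝ) (1 / 2)) : ‖q'' t‖ ≤ M :=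
    norm_radialAverage_le b₃ 2 (hlt ht)
  have bound {a b : ℂ} (ha : ‖a‖ ≤ M) (hb : ‖b‖ ≤ K) : ‖a * b‖ ≤ M * K := by
    rw [norm_mul]; exact mul_le_mul ha hb (norm_nonneg _) hM
  have key := norm_integral_mul_sin_le (h := fun t => q t * p t)
    (h' := fun t => q' t * p t + q t * p' t)
    (h'' := fun t => (q'' t * p t + q' t * p' t) + (q' t * p' t + q t * p'' t))
    (B := 4 * (M * K)) (fun t ht => (dq ht).mul (dp t ht))
    (fun t ht => ((dq' ht).mul (dp t ht)).add ((dq ht).mul (dp' t ht))) ?_ ?_ ?_ l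
  · have heq : ∀ t ∈ Set.uIcc (-(1 / 2) : ℝ) (1 / 2), (G t - G 0) *
        ((Real.sin ((2 * (l : ℝ) + 1) * π * t) / Real.sin (π * t) : ℝ) : ℂ) =
        q t * p t * ((Real.sin ((2 * (l : ℝ) + 1) * π * t) : ℝ) : ℂ) := by
      intro t ht
      rw [Set.uIcc_of_le (by norm_num)] at ht
      rcases eq_or_ne t 0 with rfl | h0
      · simp
      · have hs : (Real.sin (π * t) : ℂ) ≠ 0 := by
          intro h
          have := hp t ht
          rw [h, mul_zero, eq_comm] at this
          exact h0 (by exact_mod_cast this)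
        rw [← mul_radialAverage_eq_sub d₀ (fun t ht => (d₁ t ht).continuousAt) (hlt ht)]
        conv_lhs => rw [← hp t ht]
        change _ * q t * _ = _
        push_cast at hs ⊢
        field_simp
    rw [intervalIntegral.integral_congr heq]
    refine key.trans ?_
    gcongr ?_ / _
    nlinarith
  · have cq : ContinuousOn q (Set.Icc (-(1 / 2) : ℝ) (1 / 2)) :=
      fun t ht => (dq ht).continuousAt.continuousWithinAt
    have cq' : ContinuousOn q' (Set.Icc (-(1 / 2) : ℝ) (1 / 2)) :=
      fun t ht => (dq' ht).continuousAt.continuousWithinAt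
    have c0 : ContinuousOn p (Set.Icc (-(1 / 2) : ℝ) (1 / 2)) :=
      fun t ht => (dp t ht).continuousAt.continuousWithinAt
    have c1 : ContinuousOn p' (Set.Icc (-(1 / 2) : ℝ) (1 / 2)) :=
      fun t ht => (dp' t ht).continuousAt.continuousWithinAt
    exact ((cq''.mul c0).add (cq'.mul c1)).add ((cq'.mul c1).add (cq.mul cp''))
  · intro t ht
    obtain ⟨h0, h1, h2⟩ := bp t ht
    refine (norm_add_le_of_le (bound (bq' ht) h0) (bound (bq ht) h1)).trans ?_
    nlinarith [mul_nonneg hM hK]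
  · intro t ht
    obtain ⟨h0, h1, h2⟩ := bp t ht
    refine (norm_add_le_of_le (norm_add_le_of_le (bound (bq'' ht) h0) (bound (bq' ht) h1))
      (norm_add_le_of_le (bound (bq' ht) h1) (bound (bq ht) h2))).trans ?_
    linarith

open Polynomial in
/-- The product of a real polynomial and the Gaussian `e^{-πx²}`. -/
noncomputable def gaussPoly (P : ℝ[X]) (x : ℝ) : ℝ := P.eval x * Real.exp (-π * x ^ 2)

open Polynomial in
/-- The polynomial factor of the derivative of `gaussPoly P`. -/
noncomputable def gaussDeriv (P : ℝ[X]) : ℝ[X] := derivative P - C (2 * π) * X * P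

open Polynomial in
/-- The polynomial `Q` with `eta x = x * gaussPoly Q x`. -/
noncomputable def etaPoly : ℝ[X] := C (8 * π) * X * (C π * X ^ 2 - C (3 / 2))

lemma eta_eq_gaussPoly (x : ℝ) : eta x = gaussPoly (.X * etaPoly) x := by
  simp [eta, gaussPoly, etaPoly]; ring

lemma hasDerivAt_gaussPoly (P : Polynomial ℝ) (x : ℝ) :
    HasDerivAt (gaussPoly P) (gaussPoly (gaussDeriv P) x) x := by
  have h := (P.hasDerivAt x).mul (((hasDerivAt_pow 2 x).const_mul (-π)).exp)
  refine HasDerivAt.congr_deriv h ?_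
  simp [gaussPoly, gaussDeriv]; ring

lemma exists_gaussPoly_bound (P : Polynomial ℝ) : ∃ C, 0 ≤ C ∧ ∀ x, |gaussPoly P x| ≤ C := by
  induction P using Polynomial.induction_on' with
  | add p q hp hq =>
    obtain ⟨A, hA, hp⟩ := hp
    obtain ⟨B, hB, hq⟩ := hq
    refine ⟨A + B, by positivity, fun x => ?_⟩
    have : gaussPoly (p + q) x = gaussPoly p x + gaussPoly q x := by
      simp [gaussPoly, add_mul]
    rw [this]
    exact (abs_add_le _ _).trans (add_le_add (hp x) (hq x))
  | monomial n a =>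
    refine ⟨|a| * (n.factorial * Real.exp 1), by positivity, fun x => ?_⟩
    rw [gaussPoly, Polynomial.eval_monomial, mul_assoc, abs_mul, abs_mul, abs_pow, Real.abs_exp]
    refine mul_le_mul_of_nonneg_left ?_ (abs_nonneg a)
    have h := Real.pow_div_factorial_le_exp |x| (abs_nonneg x) n
    rw [div_le_iff₀ (by positivity)] at h
    calc |x| ^ n * Real.exp (-π * x ^ 2)
        ≤ Real.exp |x| * n.factorial * Real.exp (-π * x ^ 2) := by gcongr
      _ = n.factorial * Real.exp (|x| + -π * x ^ 2) := by rw [Real.exp_add]; ring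
      _ ≤ n.factorial * Real.exp 1 := by
        gcongr
        rw [← sq_abs x]
        nlinarith [Real.pi_gt_three, sq_nonneg (|x| - 1), sq_nonneg |x|]

/-- The weight `t^{-σ} / (1 + t)`, which dominates `g ρ` on `(0, ∞)` for `σ = Re ρ`. -/
noncomputable def singularWeight (σ t : ℝ) : ℝ := t ^ (-σ) / (1 + t)

lemma singularWeight_nonneg (σ : ℝ) {t : ℝ} (ht : 0 < t) : 0 ≤ singularWeight σ t := by
  unfold singularWeight; positivity

lemma rpow_le_one_add {σ t : ℝ} (h0 : 0 ≤ σ) (h1 : σ ≤ 1) (ht : 0 < t) : t ^ σ ≤ 1 + t := by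
  rcases le_total t 1 with h | h
  · linarith [Real.rpow_le_one ht.le h h0]
  · have := Real.rpow_le_rpow_of_exponent_le h h1
    rw [Real.rpow_one] at this
    linarith

lemma exists_gaussPoly_le_singularWeight {σ : ℝ} (h0 : 0 ≤ σ) (h1 : σ ≤ 1) (P : Polynomial ℝ) :
    ∃ C, 0 ≤ C ∧ ∀ t, 0 < t → |gaussPoly P t| ≤ C * singularWeight σ t := by
  obtain ⟨C, hC, h⟩ := exists_gaussPoly_bound ((1 + .X) ^ 2 * P)
  refine ⟨C, hC, fun t ht => ?_⟩
  have e : gaussPoly ((1 + .X) ^ 2 * P) t = (1 + t) ^ 2 * gaussPoly P t := by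
    simp [gaussPoly, mul_assoc]
  have ht' := h t
  rw [e, abs_mul, abs_of_nonneg (by positivity)] at ht'
  have hp : 0 < t ^ σ := Real.rpow_pos_of_pos ht σ
  rw [singularWeight, Real.rpow_neg ht.le, ← mul_div_assoc, le_div_iff₀ (by positivity),
    ← div_eq_mul_inv, le_div_iff₀ hp]
  calc |gaussPoly P t| * (1 + t) * t ^ σ ≤ |gaussPoly P t| * (1 + t) * (1 + t) := by
        gcongr; exact rpow_le_one_add h0 h1 ht
    _ = (1 + t) ^ 2 * |gaussPoly P t| := by ring
    _ ≤ C := ht'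

/-- The Mellin integrand of `eta` at `ρ`. -/
noncomputable def etaMellin (ρ : ℂ) (v : ℝ) : ℂ := (eta v : ℂ) * (v : ℂ) ^ (ρ - 1)

lemma continuousAt_etaMellin (ρ : ℂ) {v : ℝ} (hv : 0 < v) : ContinuousAt (etaMellin ρ) v := by
  have h1 : Continuous fun v : ℝ => (eta v : ℂ) := by unfold eta; fun_prop
  exact h1.continuousAt.mul (Complex.continuousAt_ofReal_cpow_const v _ (Or.inr hv.ne'))

lemma exists_norm_etaMellin_le {ρ : ℂ} (h0 : 0 ≤ ρ.re) (h1 : ρ.re ≤ 1) :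
    ∃ C, 0 ≤ C ∧ ∀ v, 0 < v → ‖etaMellin ρ v‖ ≤ C / (1 + v) * (1 + v ^ 2)⁻¹ := by
  obtain ⟨C, hC, h⟩ := exists_gaussPoly_bound ((1 + .X) ^ 2 * (1 + .X ^ 2) * etaPoly)
  refine ⟨C, hC, fun v hv => ?_⟩
  have e : gaussPoly ((1 + .X) ^ 2 * (1 + .X ^ 2) * etaPoly) v =
      (1 + v) ^ 2 * (1 + v ^ 2) * gaussPoly etaPoly v := by
    simp [gaussPoly, mul_assoc]
  have e' : gaussPoly (.X * etaPoly) v = v * gaussPoly etaPoly v := by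
    simp [gaussPoly, mul_assoc]
  have hv' := h v
  rw [e, abs_mul, abs_of_nonneg (by positivity)] at hv'
  have hn : ‖etaMellin ρ v‖ = |gaussPoly etaPoly v| * v ^ ρ.re := by
    rw [etaMellin, norm_mul, Complex.norm_real, eta_eq_gaussPoly, e',
      Complex.norm_cpow_eq_rpow_re_of_pos hv, Complex.sub_re, Complex.one_re,
      Real.rpow_sub_one hv.ne', Real.norm_eq_abs, abs_mul, abs_of_pos hv]
    field_simp
  rw [hn, ← div_eq_mul_inv, le_div_iff₀ (by positivity), le_div_iff₀ (by positivity)]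
  calc |gaussPoly etaPoly v| * v ^ ρ.re * (1 + v ^ 2) * (1 + v)
      ≤ |gaussPoly etaPoly v| * (1 + v) * (1 + v ^ 2) * (1 + v) := by
        gcongr; exact rpow_le_one_add h0 h1 hv
    _ = (1 + v) ^ 2 * (1 + v ^ 2) * |gaussPoly etaPoly v| := by ring
    _ ≤ C := hv'

lemma integrableOn_etaMellin {ρ : ℂ} (h0 : 0 ≤ ρ.re) (h1 : ρ.re ≤ 1) :
    IntegrableOn (etaMellin ρ) (Set.Ioi 0) := by
  obtain ⟨C, hC, h⟩ := exists_norm_etaMellin_le h0 h1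
  refine Integrable.mono' (g := fun v => C * (1 + v ^ 2)⁻¹)
    (integrable_inv_one_add_sq.const_mul C).integrableOn
    (ContinuousOn.aestronglyMeasurable (fun v hv =>
      (continuousAt_etaMellin ρ hv).continuousWithinAt) measurableSet_Ioi) ?_
  refine (ae_restrict_iff' measurableSet_Ioi).2 (.of_forall fun v hv => (h v hv).trans ?_)
  gcongr
  exact div_le_self hC (by linarith [Set.mem_Ioi.1 hv])

lemma g_eq_cpow_mul_integral (ρ : ℂ) {t : ℝ} (ht : 0 < t) :
    g ρ t = (t : ℂ) ^ (-ρ) * ∫ v in Set.Ioi t, etaMellin ρ v := by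
  have h := MeasureTheory.integral_comp_mul_right_Ioi (etaMellin ρ) 1 ht
  have htC : (t : ℂ) ≠ 0 := by exact_mod_cast ht.ne'
  have e : ∫ u in Set.Ioi (1 : ℝ), etaMellin ρ (u * t) = g ρ t * (t : ℂ) ^ (ρ - 1) := by
    rw [g, ← integral_mul_const]
    refine setIntegral_congr_fun measurableSet_Ioi fun u hu => ?_
    have hu0 : 0 ≤ u := zero_le_one.trans (Set.mem_Ioi.1 hu).le
    simp only [etaMellin, Complex.ofReal_mul]
    rw [Complex.mul_cpow_ofReal_nonneg hu0 ht.le, mul_assoc]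
  rw [e, one_mul, Complex.real_smul, Complex.cpow_sub _ _ htC, Complex.cpow_one] at h
  rw [Complex.cpow_neg]
  have hp : (t : ℂ) ^ ρ ≠ 0 := by simp [Complex.cpow_eq_zero_iff, htC]
  push_cast at h
  field_simp at h ⊢
  linear_combination h

lemma exists_norm_g_le {ρ : ℂ} (h0 : 0 ≤ ρ.re) (h1 : ρ.re ≤ 1) :
    ∃ C, 0 ≤ C ∧ ∀ t, 0 < t → ‖g ρ t‖ ≤ C * singularWeight ρ.re t := by
  obtain ⟨C, hC, h⟩ := exists_norm_etaMellin_le h0 h1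
  refine ⟨C * π, by positivity, fun t ht => ?_⟩
  have hi : Integrable (fun v : ℝ => C / (1 + t) * (1 + v ^ 2)⁻¹) :=
    integrable_inv_one_add_sq.const_mul _
  have hb : ‖∫ v in Set.Ioi t, etaMellin ρ v‖ ≤ C / (1 + t) * π := by
    calc _ ≤ ∫ v in Set.Ioi t, C / (1 + t) * (1 + v ^ 2)⁻¹ := by
          refine norm_integral_le_of_norm_le hi.integrableOn
            ((ae_restrict_iff' measurableSet_Ioi).2 (.of_forall fun v hv => ?_))
          have hv : t < v := hv
          refine (h v (ht.trans hv)).trans ?_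
          gcongr
      _ ≤ ∫ v, C / (1 + t) * (1 + v ^ 2)⁻¹ :=
          setIntegral_le_integral hi (.of_forall fun v => by simp only [Pi.zero_apply]; positivity)
      _ = C / (1 + t) * π := by rw [integral_const_mul, integral_univ_inv_one_add_sq]
  rw [g_eq_cpow_mul_integral ρ ht, norm_mul, Complex.norm_cpow_eq_rpow_re_of_pos ht,
    Complex.neg_re, singularWeight]
  calc _ ≤ t ^ (-ρ.re) * (C / (1 + t) * π) := by gcongr
    _ = _ := by ring

lemma hasDerivAt_g {ρ : ℂ} (h0 : 0 < ρ.re) (h1 : ρ.re ≤ 1) {t : ℝ} (ht : 0 < t) :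
    HasDerivAt (g ρ) (-(ρ * g ρ t + eta t) / t) t := by
  have htC : (t : ℂ) ≠ 0 := by exact_mod_cast ht.ne'
  have hint := integrableOn_etaMellin h0.le h1
  have hsub : IntegrableOn (etaMellin ρ) (Set.Ioi (t / 2)) :=
    hint.mono_set (Set.Ioi_subset_Ioi (by positivity))
  have hT : HasDerivAt (fun u => (∫ v in Set.Ioi (t / 2), etaMellin ρ v) -
      ∫ v in (t / 2)..u, etaMellin ρ v) (-etaMellin ρ t) t := by
    refine (intervalIntegral.integral_hasDerivAt_right ?_ ?_
      (continuousAt_etaMellin ρ ht)).const_sub _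
    · rw [intervalIntegrable_iff_integrableOn_Ioc_of_le (by linarith)]
      exact hsub.mono_set Set.Ioc_subset_Ioi_self
    · exact ContinuousAt.stronglyMeasurableAtFilter isOpen_Ioi
        (fun v hv => continuousAt_etaMellin ρ hv) t (Set.mem_Ioi.2 ht)
  have hρ : -ρ ≠ 0 := by
    intro h
    simp [neg_eq_zero.1 h] at h0
  have hprod := (hasDerivAt_ofReal_cpow_const ht.ne' hρ).mul hT
  have hev : g ρ =ᶠ[nhds t] fun u : ℝ => (u : ℂ) ^ (-ρ) *
      ((∫ v in Set.Ioi (t / 2), etaMellin ρ v) - ∫ v in (t / 2)..u, etaMellin ρ v) := by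
    filter_upwards [Ioi_mem_nhds (show t / 2 < t by linarith)] with u hu
    have hu : t / 2 < u := hu
    rw [g_eq_cpow_mul_integral ρ (by linarith), ← intervalIntegral.integral_Ioi_sub_Ioi hsub hu.le]
    ring
  refine HasDerivAt.congr_deriv (hprod.congr_of_eventuallyEq hev) ?_
  rw [← intervalIntegral.integral_Ioi_sub_Ioi hsub (by linarith), sub_sub_cancel,
    g_eq_cpow_mul_integral ρ ht, etaMellin, Complex.cpow_sub _ _ htC, Complex.cpow_sub _ _ htC,
    Complex.cpow_one, Complex.cpow_neg]
  have hp : (t : ℂ) ^ ρ ≠ 0 := by simp [Complex.cpow_eq_zero_iff, htC]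
  field_simp
  ring

/-- The successive derivatives of `g ρ` on `(0, ∞)`, obtained by differentiating
`t g'(t) = -ρ g(t) - eta t`. -/
noncomputable def gDeriv (ρ : ℂ) : ℕ → ℝ → ℂ
  | 0 => g ρ
  | k + 1 => fun t =>
    -((ρ + k) * gDeriv ρ k t + (gaussPoly (gaussDeriv^[k] (.X * etaPoly)) t : ℂ)) / t

lemma hasDerivAt_gDeriv {ρ : ℂ} (h0 : 0 < ρ.re) (h1 : ρ.re ≤ 1) (k : ℕ) {t : ℝ} (ht : 0 < t) :
    HasDerivAt (gDeriv ρ k) (gDeriv ρ (k + 1) t) t := by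
  have htC : (t : ℂ) ≠ 0 := by exact_mod_cast ht.ne'
  induction k with
  | zero =>
    refine HasDerivAt.congr_deriv (hasDerivAt_g h0 h1 ht) ?_
    simp [gDeriv, eta_eq_gaussPoly]
  | succ k ih =>
    have hnum := ((ih.const_mul (ρ + k)).add
      (hasDerivAt_gaussPoly (gaussDeriv^[k] (.X * etaPoly)) t).ofReal_comp).neg
    refine HasDerivAt.congr_deriv (hnum.div (hasDerivAt_id t).ofReal_comp htC) ?_
    simp only [gDeriv, Function.iterate_succ_apply', Complex.ofReal_one, Pi.add_apply, Pi.neg_apply]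
    push_cast
    field_simp
    ring

lemma exists_pow_mul_norm_gDeriv_le {ρ : ℂ} (h0 : 0 ≤ ρ.re) (h1 : ρ.re ≤ 1) (k : ℕ) :
    ∃ C, 0 ≤ C ∧ ∀ t, 0 < t → t ^ k * ‖gDeriv ρ k t‖ ≤ C * singularWeight ρ.re t := by
  induction k with
  | zero => simpa [gDeriv] using exists_norm_g_le h0 h1
  | succ k ih =>
    obtain ⟨A, hA, ih⟩ := ih
    obtain ⟨B, hB, hG⟩ := exists_gaussPoly_le_singularWeight h0 h1
      (.X ^ k * gaussDeriv^[k] (.X * etaPoly))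
    refine ⟨‖ρ + k‖ * A + B, by positivity, fun t ht => ?_⟩
    have e : gaussPoly (.X ^ k * gaussDeriv^[k] (.X * etaPoly)) t =
        t ^ k * gaussPoly (gaussDeriv^[k] (.X * etaPoly)) t := by
      simp [gaussPoly, mul_assoc]
    have hGt := hG t ht
    rw [e, abs_mul, abs_of_nonneg (by positivity)] at hGt
    have ihA := mul_le_mul_of_nonneg_left (ih t ht) (norm_nonneg (ρ + k))
    rw [gDeriv, norm_div, norm_neg, Complex.norm_real, Real.norm_of_nonneg ht.le]
    have hn := norm_add_le ((ρ + k) * gDeriv ρ k t)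
      ((gaussPoly (gaussDeriv^[k] (.X * etaPoly)) t : ℝ) : ℂ)
    rw [norm_mul, Complex.norm_real, Real.norm_eq_abs] at hn
    calc _ = t ^ k * ‖(ρ + k) * gDeriv ρ k t +
          ((gaussPoly (gaussDeriv^[k] (.X * etaPoly)) t : ℝ) : ℂ)‖ := by
            rw [pow_succ]; field_simp
      _ ≤ t ^ k * (‖ρ + k‖ * ‖gDeriv ρ k t‖ +
          |gaussPoly (gaussDeriv^[k] (.X * etaPoly)) t|) := by gcongr
      _ ≤ _ := by linarith

lemma singularWeight_le {σ : ℝ} (h0 : 0 ≤ σ) (h1 : σ ≤ 1) {n x y : ℝ} (hn : 1 ≤ n) (hx : 0 < x)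
    (hy : n * x / 4 ≤ y) : singularWeight σ y ≤ 16 * n ^ (-σ) * singularWeight σ x := by
  have hn0 : 0 < n := by linarith
  have hnx : 0 < n * x / 4 := by positivity
  have hy0 : 0 < y := hnx.trans_le hy
  have hp : y ^ (-σ) ≤ 4 * n ^ (-σ) * x ^ (-σ) := by
    calc y ^ (-σ) ≤ (n * x / 4) ^ (-σ) := Real.rpow_le_rpow_of_nonpos hnx hy (by linarith)
      _ = 4 ^ σ * (n ^ (-σ) * x ^ (-σ)) := by
        rw [Real.div_rpow (by positivity) (by norm_num), Real.mul_rpow hn0.le hx.le,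
          Real.rpow_neg (show (0 : ℝ) ≤ 4 by norm_num), div_inv_eq_mul, mul_comm]
      _ ≤ 4 * (n ^ (-σ) * x ^ (-σ)) := by
        gcongr
        simpa using Real.rpow_le_rpow_of_exponent_le (show (1 : ℝ) ≤ 4 by norm_num) h1
      _ = _ := by ring
  have hq : (1 + y)⁻¹ ≤ 4 * (1 + x)⁻¹ := by
    rw [← div_eq_mul_inv, le_div_iff₀ (by positivity), inv_mul_le_iff₀ (by positivity)]
    nlinarith
  rw [singularWeight, singularWeight, div_eq_mul_inv, div_eq_mul_inv]
  calc _ ≤ (4 * n ^ (-σ) * x ^ (-σ)) * (4 * (1 + x)⁻¹) := by gcongr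
    _ = _ := by ring

/-- A bound for the scaled derivatives of `g ρ` near the point `n x`. -/
lemma pow_mul_norm_gDeriv_le {ρ : ℂ} (h0 : 0 ≤ ρ.re) (h1 : ρ.re ≤ 1) {k : ℕ} (hk : 1 ≤ k)
    (hk3 : k ≤ 3) {C : ℝ} (hC : 0 ≤ C)
    (hg : ∀ t, 0 < t → t ^ k * ‖gDeriv ρ k t‖ ≤ C * singularWeight ρ.re t)
    {n x t : ℝ} (hn : 1 ≤ n) (hx : 0 < x) (ht : |t| < 3 / 4) :
    x ^ k * ‖gDeriv ρ k (t * x + n * x)‖ ≤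
      1024 * C * n ^ (-(1 + ρ.re)) * singularWeight ρ.re x := by
  have hn0 : 0 < n := by linarith
  set y := t * x + n * x with hy
  have hxy : n * x / 4 ≤ y := by
    rw [hy]
    nlinarith [mul_le_mul_of_nonneg_right (neg_lt_of_abs_lt ht).le hx.le]
  have hy0 : 0 < y := lt_of_lt_of_le (by positivity) hxy
  have hxk : x ^ k ≤ 64 * n⁻¹ * y ^ k := by
    calc x ^ k ≤ (4 * n⁻¹ * y) ^ k := by
          gcongr
          rw [mul_assoc, inv_mul_eq_div, ← mul_div_assoc, le_div_iff₀ hn0]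
          linarith
      _ = 4 ^ k * n⁻¹ ^ k * y ^ k := by rw [mul_pow, mul_pow]
      _ ≤ 4 ^ 3 * n⁻¹ ^ 1 * y ^ k := by
        gcongr ?_ * ?_ * _
        · exact pow_le_pow_right₀ (by norm_num) hk3
        · exact pow_le_pow_of_le_one (by positivity) (inv_le_one_of_one_le₀ hn) hk
      _ = _ := by norm_num
  calc _ ≤ 64 * n⁻¹ * y ^ k * ‖gDeriv ρ k y‖ := by gcongr
    _ = 64 * n⁻¹ * (y ^ k * ‖gDeriv ρ k y‖) := by ring
    _ ≤ 64 * n⁻¹ * (C * singularWeight ρ.re y) := by gcongr 64 * n⁻¹ * ?_; exact hg y hy0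
    _ ≤ 64 * n⁻¹ * (C * (16 * n ^ (-ρ.re) * singularWeight ρ.re x)) := by
      gcongr; exact singularWeight_le h0 h1 hn hx hxy
    _ = _ := by
      rw [neg_add, Real.rpow_add hn0, Real.rpow_neg_one]; ring

/-- The summand for the point `n x` is `O(n^{-1-Re ρ} (2l+1)⁻²)` times the weight at `x`. -/
lemma exists_norm_summand_le {ρ : ℂ} (h0 : 0 < ρ.re) (h1 : ρ.re ≤ 1) :
    ∃ A, 0 < A ∧ ∀ (l : ℕ) (n x : ℝ), 1 ≤ n → 0 < x →
      ‖∫ t in (-(1 / 2) : ℝ)..(1 / 2), (g ρ (t * x + n * x) - g ρ (n * x)) *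
        ((Real.sin ((2 * (l : ℝ) + 1) * π * t) / Real.sin (π * t) : ℝ) : ℂ)‖
        ≤ A * n ^ (-(1 + ρ.re)) * singularWeight ρ.re x / (2 * l + 1) ^ 2 := by
  obtain ⟨K, hK, hdir⟩ := exists_norm_integral_dirichlet_le
  obtain ⟨C₁, hC₁, b₁⟩ := exists_pow_mul_norm_gDeriv_le h0.le h1 1
  obtain ⟨C₂, hC₂, b₂⟩ := exists_pow_mul_norm_gDeriv_le h0.le h1 2
  obtain ⟨C₃, hC₃, b₃⟩ := exists_pow_mul_norm_gDeriv_le h0.le h1 3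
  set C := C₁ + C₂ + C₃ + 1
  refine ⟨K * (1024 * C), by positivity, fun l n x hn hx => ?_⟩
  have hpos {t : ℝ} (ht : |t| < 3 / 4) : 0 < t * x + n * x := by
    nlinarith [mul_lt_mul_of_pos_right (neg_lt_of_abs_lt ht) hx]
  have hd (k : ℕ) (t : ℝ) (ht : |t| < 3 / 4) :
      HasDerivAt (fun t : ℝ => (x : ℂ) ^ k * gDeriv ρ k (t * x + n * x))
        ((x : ℂ) ^ (k + 1) * gDeriv ρ (k + 1) (t * x + n * x)) t := by
    have h := (hasDerivAt_gDeriv h0 h1 k (hpos ht)).scomp t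
      (((hasDerivAt_id t).mul_const x).add_const (n * x))
    refine HasDerivAt.congr_deriv (h.const_mul ((x : ℂ) ^ k)) ?_
    simp only [one_mul, Complex.real_smul]
    ring
  have hb {k : ℕ} (hk : 1 ≤ k) (hk3 : k ≤ 3) {B : ℝ} (hBC : B ≤ C)
      (hB : ∀ t, 0 < t → t ^ k * ‖gDeriv ρ k t‖ ≤ B * singularWeight ρ.re t)
      (t : ℝ) (ht : |t| < 3 / 4) : ‖(x : ℂ) ^ k * gDeriv ρ k (t * x + n * x)‖ ≤
        1024 * C * n ^ (-(1 + ρ.re)) * singularWeight ρ.re x := by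
    rw [norm_mul, norm_pow, Complex.norm_real, Real.norm_of_nonneg hx.le]
    refine pow_mul_norm_gDeriv_le h0.le h1 hk hk3 (by positivity) (fun s hs => ?_) hn hx ht
    exact (hB s hs).trans (mul_le_mul_of_nonneg_right hBC (singularWeight_nonneg _ hs))
  have key := hdir _ _ _ _ _ (hd 0) (hd 1) (hd 2) (fun t ht => (hd 3 t ht).continuousAt)
    (hb le_rfl (by norm_num) (by linarith) b₁) (hb (by norm_num) (by norm_num) (by linarith) b₂)
    (hb (by norm_num) le_rfl (by linarith) b₃) l
  simp only [pow_zero, one_mul, zero_mul, zero_add, gDeriv] at key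
  refine key.trans_eq ?_
  ring

lemma integrableOn_singularWeight_sq {σ : ℝ} (h0 : 0 ≤ σ) (h1 : σ < 1 / 2) :
    IntegrableOn (fun x => singularWeight σ x ^ 2) (Set.Ioi 0) := by
  have hm : Measurable fun x => singularWeight σ x ^ 2 := by
    unfold singularWeight; fun_prop
  have hsq {x : ℝ} (hx : 0 < x) : singularWeight σ x ^ 2 = x ^ (-(2 * σ)) / (1 + x) ^ 2 := by
    rw [singularWeight, div_pow, ← Real.rpow_natCast (x ^ (-σ)) 2, ← Real.rpow_mul hx.le]
    congr 2
    push_cast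
    ring
  rw [← Set.Ioc_union_Ioi_eq_Ioi zero_le_one]
  refine IntegrableOn.union ?_ ?_
  · have hi : IntegrableOn (fun x : ℝ => x ^ (-(2 * σ))) (Set.Ioc 0 1) := by
      rw [← intervalIntegrable_iff_integrableOn_Ioc_of_le zero_le_one]
      exact intervalIntegral.intervalIntegrable_rpow' (by linarith)
    refine Integrable.mono' hi hm.aestronglyMeasurable
      ((ae_restrict_iff' measurableSet_Ioc).2 (.of_forall fun x hx => ?_))
    rw [Real.norm_of_nonneg (sq_nonneg _), hsq hx.1]
    exact div_le_self (Real.rpow_nonneg hx.1.le _) (one_le_pow₀ (by linarith [hx.1]))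
  · have hi : IntegrableOn (fun x : ℝ => x ^ (-2 : ℝ)) (Set.Ioi 1) :=
      integrableOn_Ioi_rpow_of_lt (by norm_num) one_pos
    refine Integrable.mono' hi hm.aestronglyMeasurable
      ((ae_restrict_iff' measurableSet_Ioi).2 (.of_forall fun x hx => ?_))
    have hx1 : 1 < x := hx
    have hx0 : 0 < x := zero_lt_one.trans hx1
    rw [Real.norm_of_nonneg (sq_nonneg _), hsq hx0, Real.rpow_neg hx0.le 2, Real.rpow_two,
      div_eq_mul_inv]
    refine (mul_le_of_le_one_left (by positivity)
      (Real.rpow_le_one_of_one_le_of_nonpos hx1.le (by linarith))).trans ?_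
    gcongr
    linarith

theorem stmt_10 (ρ : ℂ) (hζ : riemannZeta ρ = 0) (hρ0 : 0 < ρ.re) (hρ1 : ρ.re < 1 / 2) :
    ∃ C > (0 : ℝ), ∀ l : ℕ, 0 < l →
      (∫⁻ x in Set.Ioi (0 : ℝ),
          (‖∑' m : ℕ, ∫ t in (-(1 / 2) : ℝ)..(1 / 2),
              (g ρ (t * x + ((m : ℝ) + 1) * x) - g ρ (((m : ℝ) + 1) * x)) *
                ((Real.sin ((2 * (l : ℝ) + 1) * π * t) / Real.sin (π * t) : ℝ) : ℂ)‖₊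
            : ℝ≥0∞) ^ 2)
        ≤ ENNReal.ofReal (C / (2 * l + 1) ^ 4) := by
  have hρ1' : ρ.re ≤ 1 := by linarith
  obtain ⟨A, hA, hterm⟩ := exists_norm_summand_le hρ0 hρ1'
  have hsum : Summable fun m : ℕ => ((m : ℝ) + 1) ^ (-(1 + ρ.re)) := by
    have h := (summable_nat_add_iff 1).2 (Real.summable_nat_rpow.2
      (show -(1 + ρ.re) < -1 by linarith))
    simpa using h
  set Z : ℝ := ∑' m : ℕ, ((m : ℝ) + 1) ^ (-(1 + ρ.re)) with hZ
  have hint := integrableOn_singularWeight_sq hρ0.le hρ1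
  set I : ℝ := ∫ x in Set.Ioi (0 : ℝ), singularWeight ρ.re x ^ 2
  have hI0 : 0 ≤ I := integral_nonneg fun x => sq_nonneg _
  refine ⟨(A * Z) ^ 2 * I + 1, by positivity, fun l _ => ?_⟩
  have hpt (x : ℝ) (hx : 0 < x) :
      ‖∑' m : ℕ, ∫ t in (-(1 / 2) : ℝ)..(1 / 2),
        (g ρ (t * x + ((m : ℝ) + 1) * x) - g ρ (((m : ℝ) + 1) * x)) *
          ((Real.sin ((2 * (l : ℝ) + 1) * π * t) / Real.sin (π * t) : ℝ) : ℂ)‖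
        ≤ A * Z / (2 * l + 1) ^ 2 * singularWeight ρ.re x := by
    have hs := hsum.hasSum.mul_left (A * singularWeight ρ.re x / (2 * (l : ℝ) + 1) ^ 2)
    refine (tsum_of_norm_bounded hs fun m => ?_).trans_eq (by rw [hZ]; ring)
    exact (hterm l (m + 1) x (by simp) hx).trans_eq (by ring)
  calc _ ≤ ∫⁻ x in Set.Ioi (0 : ℝ), ENNReal.ofReal
        ((A * Z / (2 * l + 1) ^ 2) ^ 2 * singularWeight ρ.re x ^ 2) := by
        refine setLIntegral_mono' measurableSet_Ioi fun x hx => ?_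
        rw [← mul_pow, ENNReal.ofReal_pow ((norm_nonneg _).trans (hpt x hx))]
        gcongr
        rw [← enorm_eq_nnnorm, ← ofReal_norm]
        exact ENNReal.ofReal_le_ofReal (hpt x hx)
    _ = ENNReal.ofReal ((A * Z / (2 * l + 1) ^ 2) ^ 2 * I) := by
        rw [← ofReal_integral_eq_lintegral_ofReal (hint.const_mul _)
          (.of_forall fun x => by simp only [Pi.zero_apply]; positivity), integral_const_mul]
    _ ≤ _ := by
        refine ENNReal.ofReal_le_ofReal ?_
        rw [div_pow, ← pow_mul, div_mul_eq_mul_div]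
        gcongr
        linarith
end
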